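/- arXiv:2004.14032 — 3 statements merged into one kernel-verified Lean document; each statement's English description precedes it below -/
import Mathlib

section
/- Let c > 0, let φ ∈ Φ_c with κ_φ = min_{|ξ|≤c} φ̂(ξ) ∈ (0,1), and let m ≥ 2 be an integer. For ξ ∈ ℝ define Δ_m(ξ) = ∏_{0≤j<k≤m−1} |(φ̂)_p(2c(ξ+j)/m) − (φ̂)_p(2c(ξ+k)/m)|. Then for every ξ ∈ ℝ and every x ∈ ℂ^m, (1/(2e·m^{m²})) · Δ_m(ξ)² · (1−κ_φ^{2/m})/|ln κ_φ| · ‖x‖² ≤ x* ℬ_m(ξ) x ≤ m ‖x‖². -/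
open MeasureTheory Matrix
open scoped Real BigOperators

noncomputable section

/-- Fourier transform normalized as `f̂ ξ = ∫ f t · e^{-i t ξ} dt`. -/
def FT (f : ℝ → ℂ) (ξ : ℝ) : ℂ :=
  ∫ t : ℝ, Complex.exp (-(Complex.I * t * ξ)) * f t

/-- The (real-valued on `[-c,c]`) values of `φ̂` for a kernel of the class `Φ_c`. -/
def phihat (φ : ℝ → ℂ) (ξ : ℝ) : ℝ := (FT φ ξ).re

/-- The class `Φ_c`: `φ ∈ L¹`, `φ̂(0) = 1` and `κ ≤ φ̂ ≤ 1` on `[-c,c]` for some `κ > 0`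
(in particular `φ̂` is real-valued there). -/
def InPhi (c : ℝ) (φ : ℝ → ℂ) : Prop :=
  Integrable φ ∧ FT φ 0 = 1 ∧
    ∃ κ : ℝ, 0 < κ ∧ ∀ ξ : ℝ, |ξ| ≤ c →
      FT φ ξ = ((FT φ ξ).re : ℂ) ∧ κ ≤ (FT φ ξ).re ∧ (FT φ ξ).re ≤ 1

/-- `2c`-periodization of `g·1_{[-c,c)}`: for every `x` there is a unique `k ∈ ℤ` with
`x - 2ck ∈ [-c,c)`, namely `k = ⌊(x+c)/(2c)⌋`. -/
def per (c : ℝ) (g : ℝ → ℝ) (x : ℝ) : ℝ :=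
  g (x - 2*c*(⌊(x + c)/(2*c)⌋ : ℝ))

/-- `2c`-periodization of a complex-valued `g·1_{[-c,c)}`. -/
def perC (c : ℝ) (g : ℝ → ℂ) (x : ℝ) : ℂ :=
  g (x - 2*c*(⌊(x + c)/(2*c)⌋ : ℝ))

/-- The sampled diffusion matrix `ℬ_m(ξ)`. -/
def Bmat (c : ℝ) (g : ℝ → ℝ) (m : ℕ) (ξ : ℝ) : Matrix (Fin m) (Fin m) ℂ :=
  Matrix.of fun j k : Fin m =>
    (((∫ t in (0:ℝ)..1,
        per c g (2*c/(m:ℝ)*(ξ + (j.val : ℝ))) ^ t *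
          per c g (2*c/(m:ℝ)*(ξ + (k.val : ℝ))) ^ t) : ℝ) : ℂ)

/-- The value `f_t(x)` of the evolved signal, computed by Fourier inversion from
`f̂_t = ĝ^t·f̂` where `F = f̂` is supported in `[-c,c]`. -/
def heatSample (c : ℝ) (g : ℝ → ℝ) (F : ℝ → ℂ) (t x : ℝ) : ℂ :=
  ((1/(2*Real.pi) : ℝ) : ℂ) *
    ∫ ξ in (-c)..c, F ξ * (((g ξ) ^ t : ℝ) : ℂ) * Complex.exp (Complex.I * x * ξ)

/-- The vectorization `𝐟(ξ) = ((f̂)_p(2c(ξ+j)/m))_{j=0,…,m-1}`. -/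
def fvec (c : ℝ) (m : ℕ) (F : ℝ → ℂ) (ξ : ℝ) : Fin m → ℂ :=
  fun j => perC c F (2*c/(m:ℝ)*(ξ + (j.val : ℝ)))

/-- `Ψ_N(t) = (1-t²)/(1-t^{2/N})` for `t ≠ 1`, `Ψ_N(1) = N`. -/
def PsiFn (N : ℕ) (t : ℝ) : ℝ :=
  if t = 1 then (N : ℝ) else (1 - t^2)/(1 - t ^ ((2:ℝ)/(N:ℝ)))

/-- `∏_{0 ≤ j < k ≤ m-1} |v_j - v_k|`. -/
def pairProd (m : ℕ) (v : Fin m → ℝ) : ℝ :=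
  ∏ p ∈ Finset.univ.filter (fun p : Fin m × Fin m => p.1 < p.2), |v p.1 - v p.2|

/-- `σ² = Σ_j σ_j²` with `σ_j² = Σ_{k=0}^{m-1} v_j^{2k}`. -/
def sigmaSq (m : ℕ) (v : Fin m → ℝ) : ℝ :=
  ∑ j : Fin m, ∑ k : Fin m, v j ^ (2*k.val)

/-- The `(mN) × m` Vandermonde-type matrix `W_N` with entries `v_j^{(i-1)/N}`, `1 ≤ i ≤ mN`. -/
def VandW (m N : ℕ) (v : Fin m → ℝ) : Matrix (Fin (m*N)) (Fin m) ℂ :=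
  Matrix.of fun i j => (((v j ^ ((i.val : ℝ)/(N : ℝ))) : ℝ) : ℂ)

/-- `Δ_m(ξ) = ∏_{0≤j<k≤m-1} |(φ̂)_p(2c(ξ+j)/m) - (φ̂)_p(2c(ξ+k)/m)|`. -/
def DeltaM (c : ℝ) (g : ℝ → ℝ) (m : ℕ) (ξ : ℝ) : ℝ :=
  ∏ p ∈ Finset.univ.filter (fun p : Fin m × Fin m => p.1 < p.2),
    |per c g (2*c/(m:ℝ)*(ξ + (p.1.val : ℝ))) - per c g (2*c/(m:ℝ)*(ξ + (p.2.val : ℝ)))|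

/-- `(sinc(c·) * φ_t)(x) = (1/(2c)) ∫_{-c}^{c} φ̂(ξ)^t e^{ixξ} dξ`. -/
def sincConv (c : ℝ) (g : ℝ → ℝ) (t x : ℝ) : ℂ :=
  ((1/(2*c) : ℝ) : ℂ) *
    ∫ ξ in (-c)..c, (((g ξ) ^ t : ℝ) : ℂ) * Complex.exp (Complex.I * x * ξ)

/-- `c_{φ,L} = 2(κ^{2L} - 1)/(π² ln κ)`. -/
def cPhiL (κ L : ℝ) : ℝ := 2*(κ ^ (2*L) - 1)/(Real.pi^2 * Real.log κ)

/-- Legendre polynomial `P_k` via Rodrigues' formula. -/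
def legendreP (k : ℕ) : Polynomial ℝ :=
  Polynomial.C (1/((2:ℝ)^k * (Nat.factorial k : ℝ))) *
    ((fun q : Polynomial ℝ => Polynomial.derivative q)^[k] ((Polynomial.X^2 - 1)^k))

/-- Lower Beurling density. -/
def lowerDensity (Λ : Set ℝ) : ℝ :=
  Filter.liminf
    (fun r : ℝ => ⨅ x : ℝ, ((Λ ∩ Set.Icc (x - r) (x + r)).ncard : ℝ)/(2*r)) Filter.atTop

/-- Upper Beurling density. -/
def upperDensity (Λ : Set ℝ) : ℝ :=
  Filter.limsup
    (fun r : ℝ => ⨆ x : ℝ, ((Λ ∩ Set.Icc (x - r) (x + r)).ncard : ℝ)/(2*r)) Filter.atTop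

/-- Fourier transform of the Gaussian heat kernel at time 1: `φ̂(ξ) = e^{-σ²ξ²}`. -/
def GaussHat (σ : ℝ) (ξ : ℝ) : ℝ := Real.exp (-(σ^2 * ξ^2))

open scoped ComplexOrder in
/-- Lower eigenvalue bound for a positive semidefinite matrix through determinant and trace. -/
lemma psd_lower (m : ℕ) (hm : 2 ≤ m) (A : Matrix (Fin m) (Fin m) ℂ) (hA : A.PosSemidef)
    (htr : A.trace.re ≤ (m:ℝ)^2) (x : Fin m → ℂ) :
    A.det.re / (Real.exp 1 * (m:ℝ)^(m-1)) * (∑ j, ‖x j‖^2) ≤ (star x ⬝ᵥ (A *ᵥ x)).re := by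
  have hmR : (0:ℝ) < m := by exact_mod_cast (by omega : 0 < m)
  set lam := hA.1.eigenvalues with hlam
  have hnn : ∀ i, 0 ≤ lam i := hA.eigenvalues_nonneg
  have hdet : A.det.re = ∏ i, lam i := by
    rw [hA.1.det_eq_prod_eigenvalues, ← hlam]
    simp only [← Complex.ofReal_prod, Complex.coe_algebraMap, RCLike.ofReal_eq_complex_ofReal]
    exact Complex.ofReal_re _
  have htr2 : A.trace.re = ∑ i, lam i := by
    rw [hA.1.trace_eq_sum_eigenvalues, ← hlam]
    simp
  set C := A.det.re / (Real.exp 1 * (m:ℝ)^(m-1)) with hC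
  have hle : ∀ i, C ≤ lam i := by
    intro i
    rw [hC, div_le_iff₀ (by positivity), hdet, ← Finset.mul_prod_erase _ _ (Finset.mem_univ i)]
    apply mul_le_mul_of_nonneg_left _ (hnn i)
    have h1 : ∀ j ∈ Finset.univ.erase i, lam j ≤ m * Real.exp (lam j / m - 1) := by
      intro j _
      have := Real.add_one_le_exp (lam j / m - 1)
      have h2 : lam j = m * (lam j / m) := by field_simp
      calc lam j = m * (lam j / m - 1 + 1) := by field_simp; ring
        _ ≤ _ := by gcongr
    calc ∏ j ∈ Finset.univ.erase i, lam j
        ≤ ∏ j ∈ Finset.univ.erase i, ((m:ℝ) * Real.exp (lam j / m - 1)) :=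
          Finset.prod_le_prod (fun j _ => hnn j) h1
      _ = (m:ℝ)^(m-1) * Real.exp (∑ j ∈ Finset.univ.erase i, (lam j / m - 1)) := by
          rw [Finset.prod_mul_distrib, Real.exp_sum]
          simp [Finset.card_erase_of_mem]
      _ ≤ (m:ℝ)^(m-1) * Real.exp 1 := by
          gcongr
          rw [Finset.sum_sub_distrib, ← Finset.sum_div]
          have h3 : ∑ j ∈ Finset.univ.erase i, lam j ≤ (m:ℝ)^2 := by
            calc _ ≤ ∑ j, lam j := Finset.sum_le_sum_of_subset_of_nonneg
                    (Finset.erase_subset _ _) (fun j _ _ => hnn j)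
              _ ≤ _ := by rw [← htr2]; exact htr
          have h4 : (∑ j ∈ Finset.univ.erase i, lam j) / m ≤ m := by
            rw [div_le_iff₀ hmR]; nlinarith
          have h5 : (∑ j ∈ Finset.univ.erase i, (1:ℝ)) = m - 1 := by
            simp [Finset.card_erase_of_mem]
            rw [Nat.cast_sub (by omega)]; simp
          rw [h5]; linarith
      _ = _ := by ring
  have hB : (A - (C:ℂ) • (1 : Matrix (Fin m) (Fin m) ℂ)).PosSemidef := by
    have hs := hA.1.spectral_theorem
    rw [Unitary.conjStarAlgAut_apply] at hs
    set U : Matrix (Fin m) (Fin m) ℂ := (hA.1.eigenvectorUnitary : Matrix (Fin m) (Fin m) ℂ) with hU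
    have hUU : U * star U = 1 := Unitary.mul_star_self_of_mem hA.1.eigenvectorUnitary.2
    have e : A - (C:ℂ) • (1 : Matrix (Fin m) (Fin m) ℂ)
        = U * Matrix.diagonal (fun i => ((lam i - C : ℝ) : ℂ)) * Uᴴ := by
      have e2 : Matrix.diagonal (fun i => ((lam i - C : ℝ) : ℂ))
          = Matrix.diagonal (RCLike.ofReal ∘ lam) - (C:ℂ) • (1 : Matrix (Fin m) (Fin m) ℂ) := by
        ext a b
        by_cases hab : a = b
        · subst hab; simp
        · simp [hab]
      rw [e2, mul_sub, sub_mul, ← star_eq_conjTranspose]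
      have e3 : U * ((C:ℂ) • (1 : Matrix (Fin m) (Fin m) ℂ)) * star U = (C:ℂ) • 1 := by
        simp [hUU]
      rw [e3]
      exact congrArg (fun Z => Z - (C:ℂ) • (1 : Matrix (Fin m) (Fin m) ℂ)) hs
    rw [e]
    apply Matrix.PosSemidef.mul_mul_conjTranspose_same
    apply Matrix.PosSemidef.diagonal
    intro i
    have := hle i
    simp only [Pi.zero_apply]
    exact_mod_cast sub_nonneg.2 this
  have h := hB.dotProduct_mulVec_nonneg x
  have h' := (Complex.le_def.1 h).1
  rw [Matrix.sub_mulVec, dotProduct_sub, Matrix.smul_mulVec, Matrix.one_mulVec, dotProduct_smul,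
    Complex.sub_re] at h'
  have h6 : ((C:ℂ) • (star x ⬝ᵥ x)).re = C * ∑ j, ‖x j‖^2 := by
    simp only [smul_eq_mul, Complex.re_ofReal_mul, dotProduct, Complex.re_sum]
    congr 1
    apply Finset.sum_congr rfl
    intro j _
    rw [Complex.sq_norm, Complex.normSq_apply]
    simp
  rw [h6] at h'
  simp at h'
  linarith

lemma prod_pairs (m : ℕ) (f : Fin m → Fin m → ℝ) :
    ∏ p ∈ Finset.univ.filter (fun p : Fin m × Fin m => p.1 < p.2), f p.1 p.2
      = ∏ i, ∏ j ∈ Finset.Ioi i, f i j := by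
  rw [Finset.prod_filter, Fintype.prod_prod_type]
  apply Finset.prod_congr rfl
  intro i _
  rw [← Finset.prod_filter]
  congr 1
  ext j; simp

lemma card_pairs (m : ℕ) :
    2 * (Finset.univ.filter (fun p : Fin m × Fin m => p.1 < p.2)).card = m * (m-1) := by
  have h1 : (Finset.univ.filter (fun p : Fin m × Fin m => p.1 < p.2)).card
      = ∑ i : Fin m, (m - 1 - i.val) := by
    rw [Finset.card_filter, Fintype.sum_prod_type]
    apply Finset.sum_congr rfl
    intro i _
    rw [← Finset.card_filter, ← Fin.card_Ioi]
    congr 1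
    ext j; simp
  rw [h1, Fin.sum_univ_eq_sum_range (fun i => m - 1 - i), Finset.sum_range_reflect (fun i => i),
    mul_comm, Finset.sum_range_id_mul_two]

lemma abs_pow_sub_le (m : ℕ) (a b : ℝ) (ha : 0 ≤ a) (ha1 : a ≤ 1) (hb : 0 ≤ b) (hb1 : b ≤ 1) :
    |a^m - b^m| ≤ m * |a - b| := by
  rw [← geom_sum₂_mul, abs_mul]
  gcongr
  calc |∑ i ∈ Finset.range m, a ^ i * b ^ (m - 1 - i)|
      ≤ ∑ i ∈ Finset.range m, |a ^ i * b ^ (m - 1 - i)| := Finset.abs_sum_le_sum_abs _ _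
    _ ≤ ∑ i ∈ Finset.range m, (1:ℝ) := by
        apply Finset.sum_le_sum
        intro i _
        rw [abs_of_nonneg (by positivity)]
        exact mul_le_one₀ (pow_le_one₀ ha ha1) (by positivity) (pow_le_one₀ hb hb1)
    _ = m := by simp

open scoped ComplexOrder in
lemma vand_lower (m : ℕ) (hm : 2 ≤ m) (w : Fin m → ℝ) (hw0 : ∀ j, 0 ≤ w j) (hw1 : ∀ j, w j ≤ 1)
    (y : Fin m → ℂ) :
    (1 / (Real.exp 1 * (m:ℝ)^(m^2))) *
      (∏ p ∈ Finset.univ.filter (fun p : Fin m × Fin m => p.1 < p.2), |w p.1 ^ m - w p.2 ^ m|)^2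
      * (∑ j, ‖y j‖^2)
      ≤ ∑ l : Fin m, ‖∑ j, y j * ((w j ^ l.val : ℝ) : ℂ)‖^2 := by
  have hmR : (1:ℝ) ≤ m := by exact_mod_cast (by omega : 1 ≤ m)
  set W : Matrix (Fin m) (Fin m) ℂ := (Matrix.vandermonde (fun j => (w j : ℂ)))ᵀ with hW
  have hWe : ∀ l j, W l j = ((w j ^ l.val : ℝ) : ℂ) := by
    intro l j; simp [hW, Matrix.vandermonde_apply]
  have hpsd : (Wᴴ * W).PosSemidef := Matrix.posSemidef_conjTranspose_mul_self W
  have htr : (Wᴴ * W).trace.re ≤ (m:ℝ)^2 := by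
    simp only [Matrix.trace, Matrix.diag, Matrix.mul_apply, Complex.re_sum,
      Matrix.conjTranspose_apply, hWe]
    calc _ ≤ ∑ i : Fin m, ∑ j : Fin m, (1:ℝ) := by
          apply Finset.sum_le_sum; intro i _
          apply Finset.sum_le_sum; intro j _
          have : (star ((w i ^ j.val : ℝ) : ℂ) * ((w i ^ j.val : ℝ) : ℂ)).re
              = w i ^ j.val * w i ^ j.val := by
            rw [Complex.star_def, Complex.conj_ofReal, ← Complex.ofReal_mul, Complex.ofReal_re]
          rw [this]
          have h0 := hw0 i
          have h1 := hw1 i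
          exact mul_le_one₀ (pow_le_one₀ h0 h1) (by positivity) (pow_le_one₀ h0 h1)
      _ = _ := by simp; ring
  have hdet : (Wᴴ * W).det.re
      = (∏ p ∈ Finset.univ.filter (fun p : Fin m × Fin m => p.1 < p.2), |w p.1 - w p.2|)^2 := by
    have h1 : W.det = ((∏ i, ∏ j ∈ Finset.Ioi i, (w j - w i) : ℝ) : ℂ) := by
      rw [hW, Matrix.det_transpose, Matrix.det_vandermonde]
      push_cast; rfl
    rw [Matrix.det_mul, Matrix.det_conjTranspose, h1, Complex.star_def, Complex.conj_ofReal,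
      ← Complex.ofReal_mul, Complex.ofReal_re, prod_pairs m (fun i j => |w i - w j|), ← sq,
      ← sq_abs, Finset.abs_prod]
    congr 1
    apply Finset.prod_congr rfl
    intro i _
    rw [Finset.abs_prod]
    apply Finset.prod_congr rfl
    intro j _
    exact abs_sub_comm _ _
  have hq : (star y ⬝ᵥ ((Wᴴ * W) *ᵥ y)).re = ∑ l : Fin m, ‖∑ j, y j * ((w j ^ l.val : ℝ) : ℂ)‖^2 := by
    rw [← Matrix.mulVec_mulVec, Matrix.dotProduct_mulVec, ← Matrix.star_mulVec]
    simp only [dotProduct, Complex.re_sum]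
    apply Finset.sum_congr rfl
    intro l _
    have : (W *ᵥ y) l = ∑ j, y j * ((w j ^ l.val : ℝ) : ℂ) := by
      simp only [Matrix.mulVec, dotProduct, hWe]
      exact Finset.sum_congr rfl fun j _ => mul_comm _ _
    rw [Pi.star_apply, this, Complex.sq_norm, Complex.normSq_apply]
    simp only [Complex.star_def, Complex.mul_re, Complex.conj_re, Complex.conj_im]
    ring
  have key := psd_lower m hm _ hpsd htr y
  rw [hq, hdet] at key
  refine le_trans ?_ key
  gcongr ?_ * _
  have hprod : (∏ p ∈ Finset.univ.filter (fun p : Fin m × Fin m => p.1 < p.2),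
      |w p.1 ^ m - w p.2 ^ m|)
      ≤ (m:ℝ)^(Finset.univ.filter (fun p : Fin m × Fin m => p.1 < p.2)).card *
        ∏ p ∈ Finset.univ.filter (fun p : Fin m × Fin m => p.1 < p.2), |w p.1 - w p.2| := by
    rw [← Finset.prod_const, ← Finset.prod_mul_distrib]
    apply Finset.prod_le_prod (fun _ _ => abs_nonneg _)
    intro p _
    exact abs_pow_sub_le m _ _ (hw0 _) (hw1 _) (hw0 _) (hw1 _)
  have hpn : 0 ≤ ∏ p ∈ Finset.univ.filter (fun p : Fin m × Fin m => p.1 < p.2),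
      |w p.1 ^ m - w p.2 ^ m| := Finset.prod_nonneg fun _ _ => abs_nonneg _
  have hsq := pow_le_pow_left₀ hpn hprod 2
  rw [mul_pow, ← pow_mul, mul_comm _ 2, card_pairs] at hsq
  set P := ∏ p ∈ Finset.univ.filter (fun p : Fin m × Fin m => p.1 < p.2), |w p.1 - w p.2|
  set Q := ∏ p ∈ Finset.univ.filter (fun p : Fin m × Fin m => p.1 < p.2), |w p.1 ^ m - w p.2 ^ m|
  rw [one_div, inv_mul_eq_div, div_le_div_iff₀ (by positivity) (by positivity)]
  have hpow : (m:ℝ)^(m*(m-1)) * (m:ℝ)^(m-1) ≤ (m:ℝ)^(m^2) := by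
    rw [← pow_add]
    apply pow_le_pow_right₀ hmR
    obtain ⟨n, rfl⟩ : ∃ n, m = n + 1 := ⟨m-1, by omega⟩
    simp; nlinarith
  calc Q^2 * (Real.exp 1 * (m:ℝ)^(m-1))
      ≤ ((m:ℝ)^(m*(m-1)) * P^2) * (Real.exp 1 * (m:ℝ)^(m-1)) := by gcongr
    _ = P^2 * (Real.exp 1 * ((m:ℝ)^(m*(m-1)) * (m:ℝ)^(m-1))) := by ring
    _ ≤ _ := by gcongr

/-- The quadratic form as an integral. -/
lemma quad_eq (m : ℕ) (v : Fin m → ℝ) (hv : ∀ j, 0 < v j) (x : Fin m → ℂ) :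
    (star x ⬝ᵥ ((Matrix.of fun j k : Fin m =>
      (((∫ t in (0:ℝ)..1, v j ^ t * v k ^ t) : ℝ) : ℂ)) *ᵥ x)).re
    = ∫ t in (0:ℝ)..1, ‖∑ j, x j * ((v j ^ t : ℝ) : ℂ)‖^2 := by
  have hcont : ∀ j, Continuous fun t : ℝ => v j ^ t := fun j =>
    Real.continuous_const_rpow (hv j).ne'
  have e : ∀ t : ℝ, ‖∑ j, x j * ((v j ^ t : ℝ) : ℂ)‖^2
      = ∑ j, ∑ k, (star (x j) * x k).re * (v j ^ t * v k ^ t) := by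
    intro t
    have h1 : ((‖∑ j, x j * ((v j ^ t : ℝ) : ℂ)‖^2 : ℝ) : ℂ)
        = ∑ j, ∑ k, (star (x j) * x k) * ((v j ^ t * v k ^ t : ℝ) : ℂ) := by
      rw [Complex.ofReal_pow, ← Complex.conj_mul', map_sum, Finset.sum_mul_sum]
      apply Finset.sum_congr rfl; intro j _
      apply Finset.sum_congr rfl; intro k _
      rw [map_mul, Complex.conj_ofReal, Complex.star_def]
      push_cast; ring
    have h2 := congrArg Complex.re h1
    rw [Complex.ofReal_re] at h2
    rw [h2]
    simp only [Complex.re_sum, Complex.re_mul_ofReal]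
  simp only [e]
  rw [intervalIntegral.integral_finsetSum]
  · simp only [dotProduct, Matrix.mulVec, Complex.re_sum, Finset.mul_sum]
    apply Finset.sum_congr rfl; intro j _
    rw [intervalIntegral.integral_finsetSum]
    · apply Finset.sum_congr rfl; intro k _
      rw [intervalIntegral.integral_const_mul, Matrix.of_apply, Pi.star_apply, mul_left_comm,
        Complex.re_ofReal_mul, mul_comm]
    · intro k _
      apply Continuous.intervalIntegrable
      exact continuous_const.mul ((hcont j).mul (hcont k))
  · intro j _
    apply Continuous.intervalIntegrable
    exact continuous_finsetSum _ fun k _ => continuous_const.mul ((hcont j).mul (hcont k))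

lemma split_integral (m : ℕ) (hm : 0 < m) (F : ℝ → ℝ) (hF : Continuous F) :
    ∫ t in (0:ℝ)..1, F t = ∫ s in (0:ℝ)..(1/(m:ℝ)), ∑ l : Fin m, F (s + l.val/(m:ℝ)) := by
  have hmR : (0:ℝ) < m := by exact_mod_cast hm
  rw [intervalIntegral.integral_finsetSum]
  · have h := intervalIntegral.sum_integral_adjacent_intervals (f := F) (μ := volume)
      (a := fun k : ℕ => (k:ℝ)/(m:ℝ)) (n := m) (fun k _ => hF.intervalIntegrable _ _)
    simp only [Nat.cast_zero, zero_div, div_self hmR.ne'] at h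
    rw [← h, ← Fin.sum_univ_eq_sum_range
      (fun k => ∫ x in ((k:ℝ)/(m:ℝ))..(((k+1:ℕ):ℝ)/(m:ℝ)), F x)]
    apply Finset.sum_congr rfl
    intro l _
    rw [intervalIntegral.integral_comp_add_right]
    congr 1
    · simp
    · push_cast; ring
  · intro l _
    apply Continuous.intervalIntegrable
    fun_prop

lemma integral_kappa (κ a : ℝ) (h0 : 0 < κ) (h1 : κ < 1) :
    ∫ s in (0:ℝ)..a, κ ^ (2*s) = (1 - κ ^ (2*a)) / (2*|Real.log κ|) := by
  have hl : Real.log κ < 0 := Real.log_neg h0 h1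
  have hd : ∀ s ∈ Set.uIcc 0 a,
      HasDerivAt (fun s : ℝ => κ ^ (2*s) / (2 * Real.log κ)) (κ ^ (2*s)) s := by
    intro s _
    have h2 : HasDerivAt (fun s : ℝ => 2 * s) (2 * 1) s := (hasDerivAt_id s).const_mul 2
    refine ((h2.const_rpow h0).div_const (2 * Real.log κ)).congr_deriv (Eq.symm ?_)
    have hl' := hl.ne
    rw [eq_div_iff (by simpa using hl')]
    ring
  rw [intervalIntegral.integral_eq_sub_of_hasDerivAt hd, abs_of_neg hl]
  · simp
    field_simp
    ring
  · apply Continuous.intervalIntegrable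
    exact (Real.continuous_const_rpow h0.ne').comp (continuous_const.mul continuous_id)

lemma main_bounds (m : ℕ) (hm : 2 ≤ m) (v : Fin m → ℝ) (κ : ℝ) (hκ0 : 0 < κ) (hκ1 : κ < 1)
    (hv : ∀ j, κ ≤ v j) (hv1 : ∀ j, v j ≤ 1) (x : Fin m → ℂ) :
    (1/(2*Real.exp 1*(m:ℝ)^(m^2))) *
      (∏ p ∈ Finset.univ.filter (fun p : Fin m × Fin m => p.1 < p.2), |v p.1 - v p.2|)^2 *
        ((1 - κ ^ ((2:ℝ)/(m:ℝ)))/|Real.log κ|) * (∑ j, ‖x j‖^2)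
      ≤ ∫ t in (0:ℝ)..1, ‖∑ j, x j * ((v j ^ t : ℝ) : ℂ)‖^2
    ∧ ∫ t in (0:ℝ)..1, ‖∑ j, x j * ((v j ^ t : ℝ) : ℂ)‖^2 ≤ (m:ℝ) * (∑ j, ‖x j‖^2) := by
  have hmR : (0:ℝ) < m := by exact_mod_cast (by omega : 0 < m)
  have hv0 : ∀ j, 0 < v j := fun j => hκ0.trans_le (hv j)
  have hFc : Continuous fun t : ℝ => ‖∑ j, x j * ((v j ^ t : ℝ) : ℂ)‖^2 := by
    refine (Continuous.norm ?_).pow 2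
    exact continuous_finsetSum _ fun k _ => continuous_const.mul
      (Complex.continuous_ofReal.comp (Real.continuous_const_rpow (hv0 k).ne'))
  constructor
  · rw [split_integral m (by omega) _ hFc]
    set D := ∏ p ∈ Finset.univ.filter (fun p : Fin m × Fin m => p.1 < p.2), |v p.1 - v p.2| with hD
    have hpt : ∀ s ∈ Set.Icc (0:ℝ) (1/(m:ℝ)),
        (1 / (Real.exp 1 * (m:ℝ)^(m^2))) * D^2 * (∑ j, ‖x j‖^2) * κ ^ (2*s)
        ≤ ∑ l : Fin m, ‖∑ j, x j * ((v j ^ (s + l.val/(m:ℝ)) : ℝ) : ℂ)‖^2 := by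
      intro s hs
      have h := vand_lower m hm (fun j => v j ^ (1/(m:ℝ))) (fun j => (Real.rpow_pos_of_pos (hv0 j) _).le)
        (fun j => Real.rpow_le_one (hv0 j).le (hv1 j) (by positivity))
        (fun j => x j * ((v j ^ s : ℝ) : ℂ))
      have hw : ∀ j, (v j ^ (1/(m:ℝ))) ^ m = v j := by
        intro j
        rw [← Real.rpow_mul_natCast (hv0 j).le, one_div, inv_mul_cancel₀ hmR.ne', Real.rpow_one]
      simp only [hw] at h
      rw [← hD] at h
      have e : ∀ l j : Fin m, x j * ((v j ^ s : ℝ) : ℂ) * (((v j ^ (1/(m:ℝ)))^l.val : ℝ) : ℂ)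
          = x j * ((v j ^ (s + l.val/(m:ℝ)) : ℝ) : ℂ) := by
        intro l j
        rw [mul_assoc, ← Complex.ofReal_mul, ← Real.rpow_mul_natCast (hv0 j).le,
          ← Real.rpow_add (hv0 j)]
        congr 4
        ring
      simp only [e] at h
      refine le_trans ?_ h
      rw [mul_assoc _ _ (κ ^ (2*s))]
      gcongr ?_ * ?_
      rw [Finset.sum_mul]
      apply Finset.sum_le_sum
      intro j _
      rw [norm_mul, mul_pow, Complex.norm_real, Real.norm_of_nonneg (Real.rpow_pos_of_pos (hv0 j) _).le]
      gcongr
      rw [mul_comm, Real.rpow_mul hκ0.le, Real.rpow_two]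
      gcongr
      · exact hs.1
      · exact hv j
    have hmono := intervalIntegral.integral_mono_on (μ := volume) (a := 0) (b := 1/(m:ℝ))
      (f := fun s => (1 / (Real.exp 1 * (m:ℝ)^(m^2))) * D^2 * (∑ j, ‖x j‖^2) * κ ^ (2*s))
      (g := fun s => ∑ l : Fin m, ‖∑ j, x j * ((v j ^ (s + l.val/(m:ℝ)) : ℝ) : ℂ)‖^2)
      (by positivity)
      (Continuous.intervalIntegrable (continuous_const.mul
        ((Real.continuous_const_rpow hκ0.ne').comp (continuous_const.mul continuous_id))) _ _)
      (Continuous.intervalIntegrable (continuous_finsetSum _ fun l _ =>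
        hFc.comp (continuous_id.add continuous_const)) _ _) hpt
    refine le_trans (le_of_eq ?_) hmono
    rw [intervalIntegral.integral_const_mul, integral_kappa κ _ hκ0 hκ1, mul_one_div]
    have hl : |Real.log κ| ≠ 0 := abs_ne_zero.2 (Real.log_neg hκ0 hκ1).ne
    field_simp
  · have hb : ∀ t ∈ Set.Icc (0:ℝ) 1, ‖∑ j, x j * ((v j ^ t : ℝ) : ℂ)‖^2 ≤ (m:ℝ) * (∑ j, ‖x j‖^2) := by
      intro t ht
      have h1 : ‖∑ j, x j * ((v j ^ t : ℝ) : ℂ)‖ ≤ ∑ j, ‖x j‖ := by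
        refine (norm_sum_le _ _).trans (Finset.sum_le_sum fun j _ => ?_)
        rw [norm_mul, Complex.norm_real, Real.norm_of_nonneg (Real.rpow_pos_of_pos (hv0 j) _).le]
        exact mul_le_of_le_one_right (norm_nonneg _) (Real.rpow_le_one (hv0 j).le (hv1 j) ht.1)
      have h2 := sq_sum_le_card_mul_sum_sq (s := (Finset.univ : Finset (Fin m))) (f := fun j => ‖x j‖)
      simp only [Finset.card_univ, Fintype.card_fin] at h2
      exact (pow_le_pow_left₀ (norm_nonneg _) h1 2).trans h2
    have hmono := intervalIntegral.integral_mono_on (μ := volume) (a := 0) (b := 1)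
      (by norm_num) (hFc.intervalIntegrable _ _)
      (continuous_const.intervalIntegrable _ _) hb
    simpa using hmono

/-- Proposition `cor:Sec5`. -/
theorem stmt3 (c : ℝ) (hc : 0 < c) (φ : ℝ → ℂ) (κ : ℝ)
    (hφI : Integrable φ) (hφ0 : FT φ 0 = 1)
    (hreal : ∀ ξ : ℝ, |ξ| ≤ c → FT φ ξ = ((FT φ ξ).re : ℂ))
    (hup : ∀ ξ : ℝ, |ξ| ≤ c → phihat φ ξ ≤ 1)
    (hmin : IsLeast (phihat φ '' {ξ : ℝ | |ξ| ≤ c}) κ)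
    (hκ0 : 0 < κ) (hκ1 : κ < 1)
    (m : ℕ) (hm : 2 ≤ m) (ξ : ℝ) (x : Fin m → ℂ) :
    (1/(2*Real.exp 1*(m:ℝ)^(m^2))) * (DeltaM c (phihat φ) m ξ)^2 *
        ((1 - κ ^ ((2:ℝ)/(m:ℝ)))/|Real.log κ|) * (∑ j, ‖x j‖^2)
      ≤ (star x ⬝ᵥ (Bmat c (phihat φ) m ξ *ᵥ x)).re
    ∧ (star x ⬝ᵥ (Bmat c (phihat φ) m ξ *ᵥ x)).re ≤ (m:ℝ) * (∑ j, ‖x j‖^2) := by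
  have hmR : (0:ℝ) < m := by exact_mod_cast (by omega : 0 < m)
  have hper : ∀ y : ℝ, κ ≤ per c (phihat φ) y ∧ per c (phihat φ) y ≤ 1 := by
    intro y
    have hab : |y - 2*c*(⌊(y + c)/(2*c)⌋ : ℝ)| ≤ c := by
      have h1 := Int.floor_le ((y + c)/(2*c))
      have h2 := Int.lt_floor_add_one ((y + c)/(2*c))
      rw [le_div_iff₀ (by positivity)] at h1
      rw [div_lt_iff₀ (by positivity)] at h2
      rw [abs_le]
      constructor <;> nlinarith
    exact ⟨hmin.2 ⟨_, hab, rfl⟩, hup _ hab⟩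
  have h := main_bounds m hm
    (fun j : Fin m => per c (phihat φ) (2*c/(m:ℝ)*(ξ + (j.val : ℝ)))) κ hκ0 hκ1
    (fun j => (hper _).1) (fun j => (hper _).2) x
  rw [← quad_eq m _ (fun j => hκ0.trans_le (hper _).1) x] at h
  exact h
end
end

section
/- Let c > 0. There exist positive constants κ₀, κ₁, κ₂, κ₃ depending only on c with the following property: for every σ ≠ 0, every integer m ≥ 2, every N ∈ ℕ, and every f ∈ PW_c whose Fourier transform f̂ is the restriction to [−c,c] of a polynomial of degree at most N (equivalently, f is a linear combination of the derivatives D^n sinc(c·), 0 ≤ n ≤ N), one has κ·‖f̂‖²_{L²} ≤ ∫₀¹ Σ_{k∈ℤ} |f_t(mπk/c)|² dt ≤ (c/(2π²))·‖f̂‖²_{L²}, where κ = (c·κ₀/((σc)²+m)) · exp(−κ₁N − m²(−κ₂ ln|σ| + κ₃σ² + ln m)) and f_t is the heat flow of f with kernel φ̂(ξ) = e^{−σ²ξ²}. -/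
open MeasureTheory Matrix
open scoped Real BigOperators

noncomputable section

/-- Splitting an integral into `n` translates. -/
theorem aux_split {E : Type*} [NormedAddCommGroup E] [NormedSpace ℝ E]
    (g : ℝ → E) (hg : Continuous g) (a δ : ℝ) (n : ℕ) :
    ∫ x in a..(a + n * δ), g x =
      ∫ s in (0:ℝ)..δ, ∑ i ∈ Finset.range n, g (a + i * δ + s) := by
  rw [intervalIntegral.integral_finsetSum (f := fun (i : ℕ) s => g (a + i * δ + s))
    (fun i _ => (by fun_prop : Continuous fun s => g (a + i * δ + s)).intervalIntegrable _ _)]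
  have h := intervalIntegral.sum_integral_adjacent_intervals (μ := volume) (f := g)
    (a := fun k : ℕ => a + k * δ) (n := n) (fun k _ => hg.intervalIntegrable _ _)
  simp only [Nat.cast_zero, zero_mul, add_zero] at h
  rw [← h]
  refine Finset.sum_congr rfl fun i _ => ?_
  rw [intervalIntegral.integral_comp_add_left (fun s => g s)]
  congr 1
  · ring
  · push_cast; ring

/-- Extraction of one coefficient of an exponential sum from consecutive samples. -/
theorem aux_expsum {ι : Type*} [DecidableEq ι] (v : ι → ℝ) (hv : ∀ i, 0 ≤ v i ∧ v i ≤ 1) (j : ι)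
    (T : Finset ι) : ∀ (b : ι → ℂ) (B : ℝ), j ∉ T →
      (∀ i : ℕ, i ≤ T.card → ‖∑ l ∈ insert j T, b l * ((v l : ℝ) : ℂ) ^ i‖ ≤ B) →
      ‖b j‖ * ∏ k ∈ T, |v j - v k| ≤ 2 ^ T.card * B := by
  induction T using Finset.induction_on with
  | empty =>
    intro b B _ h
    simpa using h 0 le_rfl
  | insert k T hk ih =>
    intro b B hj h
    have hjk : j ≠ k := fun e => hj (by simp [e])
    have hjT : j ∉ T := fun e => hj (by simp [e])
    have hkj : k ∉ insert j T := by
      simp [hk, hjk.symm]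
    have := ih (fun l => b l * ((v l : ℂ) - v k)) (2 * B) hjT ?_
    · rw [Finset.prod_insert hk, Finset.card_insert_of_notMem hk]
      have e : ‖b j * ((v j : ℂ) - v k)‖ = ‖b j‖ * |v j - v k| := by
        rw [norm_mul, ← Complex.ofReal_sub, Complex.norm_real, Real.norm_eq_abs]
      simp only [e] at this
      calc _ = ‖b j‖ * |v j - v k| * ∏ k ∈ T, |v j - v k| := by ring
        _ ≤ _ := this
        _ = _ := by ring
    · intro i hi
      have hc : (insert k T).card = T.card + 1 := Finset.card_insert_of_notMem hk
      have h1 := h (i+1) (by omega)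
      have h0 := h i (by omega)
      have e : ∑ l ∈ insert j T, b l * ((v l : ℂ) - v k) * (v l : ℂ) ^ i =
          (∑ l ∈ insert j (insert k T), b l * (v l : ℂ) ^ (i+1))
            - v k * ∑ l ∈ insert j (insert k T), b l * (v l : ℂ) ^ i := by
        rw [Finset.insert_comm, Finset.sum_insert hkj, Finset.sum_insert hkj, mul_add,
          Finset.mul_sum]
        have : ∑ l ∈ insert j T, b l * ((v l : ℂ) - v k) * (v l : ℂ) ^ i =
          ∑ l ∈ insert j T, b l * (v l : ℂ) ^ (i+1) -
            ∑ l ∈ insert j T, (v k : ℂ) * (b l * (v l : ℂ) ^ i) := by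
          rw [← Finset.sum_sub_distrib]
          exact Finset.sum_congr rfl fun l _ => by ring
        rw [this]; ring
      rw [e]
      refine (norm_sub_le _ _).trans ?_
      rw [norm_mul, Complex.norm_real, Real.norm_eq_abs, abs_of_nonneg (hv k).1]
      have hB : 0 ≤ B := (norm_nonneg _).trans h0
      have : v k * ‖∑ l ∈ insert j (insert k T), b l * (v l : ℂ) ^ i‖ ≤ 1 * B :=
        mul_le_mul (hv k).2 h0 (norm_nonneg _) zero_le_one
      linarith

theorem aux_prod_fact (i r : ℕ) :
    ∏ j ∈ (Finset.range (i + 1 + r)).erase i, |(i:ℝ) - j| = (i.factorial : ℝ) * r.factorial := by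
  have hmem : i ∈ Finset.range (i + 1 + r) := by simp; omega
  have h1 : ∏ j ∈ (Finset.range (i + 1 + r)).erase i, |(i:ℝ) - j| =
      ∏ j ∈ Finset.range (i + 1 + r), (if j = i then 1 else |(i:ℝ) - j|) := by
    rw [← Finset.mul_prod_erase _ _ hmem]
    simp only [if_true, one_mul]
    exact Finset.prod_congr rfl fun j hj => by simp [Finset.ne_of_mem_erase hj]
  rw [h1, Finset.prod_range_add, Finset.prod_range_succ]
  simp only [if_true, mul_one]
  congr 1
  · rw [← Finset.prod_range_reflect, ← Finset.prod_range_add_one_eq_factorial]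
    push_cast
    refine Finset.prod_congr rfl fun j hj => ?_
    have := Finset.mem_range.1 hj
    rw [if_neg (by omega)]
    have e : ((i - 1 - j : ℕ) : ℝ) = (i:ℝ) - 1 - j := by
      rw [Nat.sub_sub, Nat.cast_sub (by omega)]; push_cast; ring
    rw [e, show (i:ℝ) - ((i:ℝ) - 1 - j) = j + 1 by ring]
    exact abs_of_nonneg (by positivity)
  · rw [← Finset.prod_range_add_one_eq_factorial]
    push_cast
    refine Finset.prod_congr rfl fun j hj => ?_
    rw [if_neg (by omega)]
    rw [show (i:ℝ) - ((i:ℝ) + 1 + j) = -(j + 1) by ring, abs_neg]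
    exact abs_of_nonneg (by positivity)

/-- Lagrange interpolation bound at equally spaced nodes. -/
theorem aux_lagrange (N : ℕ) (P : Polynomial ℂ) (hP : P.natDegree ≤ N) (x b δ h B : ℝ)
    (hδ : 0 < δ) (hh : 0 ≤ h)
    (hx : ∀ i ∈ Finset.range (N+1), |x - (b + i * δ)| ≤ h)
    (hB : ∀ i ∈ Finset.range (N+1), ‖P.eval ((b + i * δ : ℝ) : ℂ)‖ ≤ B) :
    ‖P.eval (x:ℂ)‖ ≤ (2 * h / δ) ^ N / N.factorial * B := by
  have hinj : Set.InjOn (fun i : ℕ => ((b + i * δ : ℝ) : ℂ)) (Finset.range (N+1) : Set ℕ) := by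
    intro i _ j _ hij
    have : b + i * δ = b + j * δ := Complex.ofReal_injective hij
    have : (i:ℝ) = j := by
      have := add_left_cancel this
      exact mul_right_cancel₀ hδ.ne' this
    exact_mod_cast this
  have hdeg : P.degree < (Finset.range (N+1)).card := by
    rw [Finset.card_range]
    exact Polynomial.degree_le_natDegree.trans_lt (by exact_mod_cast Nat.lt_succ_of_le hP)
  have hB0 : 0 ≤ B := (norm_nonneg _).trans (hB 0 (by simp))
  rw [Lagrange.eq_interpolate hinj hdeg, Lagrange.interpolate_apply, Polynomial.eval_finsetSum]
  have hterm : ∀ i ∈ Finset.range (N+1),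
      ‖(Polynomial.C (P.eval ((b + i * δ : ℝ) : ℂ)) *
        Lagrange.basis (Finset.range (N+1)) (fun i : ℕ => ((b + i * δ : ℝ) : ℂ)) i).eval (x:ℂ)‖
        ≤ B * ((h/δ)^N / N.factorial * (N.choose i)) := by
    intro i hi
    rw [Polynomial.eval_mul, Polynomial.eval_C, norm_mul]
    refine mul_le_mul (hB i hi) ?_ (norm_nonneg _) hB0
    rw [Lagrange.basis, Polynomial.eval_prod, norm_prod]
    obtain ⟨r, hr⟩ : ∃ r, N = i + r := ⟨N - i, by have := Finset.mem_range.1 hi; omega⟩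
    have hN : N + 1 = i + 1 + r := by omega
    have hcard : ((Finset.range (N+1)).erase i).card = N := by
      rw [Finset.card_erase_of_mem hi, Finset.card_range]; rfl
    have hle : ∏ j ∈ (Finset.range (N+1)).erase i,
        ‖(Lagrange.basisDivisor ((b + i * δ : ℝ) : ℂ) ((b + j * δ : ℝ) : ℂ)).eval (x:ℂ)‖
        ≤ ∏ j ∈ (Finset.range (N+1)).erase i, ((h/δ) / |(i:ℝ) - j|) := by
      refine Finset.prod_le_prod (fun _ _ => norm_nonneg _) fun j hj => ?_
      have hj' := hx j (Finset.mem_of_mem_erase hj)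
      have hij : (i:ℝ) - j ≠ 0 := by
        have := Finset.ne_of_mem_erase hj
        rw [sub_ne_zero]; exact_mod_cast this.symm
      rw [Lagrange.basisDivisor, Polynomial.eval_mul, Polynomial.eval_C, Polynomial.eval_sub,
        Polynomial.eval_X, Polynomial.eval_C, ← Complex.ofReal_sub, ← Complex.ofReal_sub,
        ← Complex.ofReal_inv, ← Complex.ofReal_mul, Complex.norm_real, Real.norm_eq_abs, abs_mul,
        abs_inv, show b + i * δ - (b + j * δ) = (i - j) * δ by ring, abs_mul, abs_of_pos hδ]
      have : 0 < |(i:ℝ) - j| := abs_pos.2 hij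
      rw [div_div, div_eq_inv_mul, mul_comm δ]
      gcongr
    refine hle.trans (le_of_eq ?_)
    rw [Finset.prod_div_distrib, Finset.prod_const, hcard]
    rw [show Finset.range (N+1) = Finset.range (i+1+r) by rw [hN], aux_prod_fact]
    have hch := Nat.add_choose_mul_factorial_mul_factorial i r
    have hch' : ((N.choose i : ℕ) : ℝ) * i.factorial * r.factorial = N.factorial := by
      rw [hr, Nat.choose_symm_add]; exact_mod_cast hch
    rw [← hch']
    have : (N.choose i : ℝ) ≠ 0 := by
      have := Nat.choose_pos (show i ≤ N by omega)
      exact_mod_cast this.ne'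
    have h2 : (i.factorial : ℝ) ≠ 0 := by exact_mod_cast i.factorial_ne_zero
    have h3 : (r.factorial : ℝ) ≠ 0 := by exact_mod_cast r.factorial_ne_zero
    field_simp
  refine (norm_sum_le _ _).trans ((Finset.sum_le_sum hterm).trans (le_of_eq ?_))
  rw [← Finset.mul_sum, ← Finset.mul_sum]
  have : ∑ i ∈ Finset.range (N+1), (N.choose i : ℝ) = 2 ^ N := by
    exact_mod_cast Nat.sum_range_choose N
  rw [this, show 2 * h / δ = h / δ * 2 by ring, mul_pow]
  ring

/-- A Remez type inequality for one interval. -/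
theorem aux_remez (N : ℕ) (P : Polynomial ℂ) (hP : P.natDegree ≤ N) (a h : ℝ) (hh : 0 < h) :
    ∫ x in a..(a+h), ‖P.eval (x:ℂ)‖^2 ≤
      Real.exp (4 + 8 * N) * ∫ s in (h/8)..(3*h/8), ‖P.eval ((a + s : ℝ):ℂ)‖^2 := by
  set δ : ℝ := h / 4 / (N+1) with hδd
  have hδ : 0 < δ := by positivity
  have hNδ : (N+1) * δ = h/4 := by rw [hδd]; field_simp
  have hcont : Continuous fun x : ℝ => ‖P.eval (x:ℂ)‖^2 := by fun_prop
  set J := ∫ s in (h/8)..(3*h/8), ‖P.eval ((a + s : ℝ):ℂ)‖^2 with hJ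
  have hJs : J = ∫ s in (0:ℝ)..δ, ∑ i ∈ Finset.range (N+1),
      ‖P.eval ((a + h/8 + i * δ + s : ℝ):ℂ)‖^2 := by
    have := aux_split (fun x : ℝ => ‖P.eval (x:ℂ)‖^2) hcont (a + h/8) δ (N+1)
    rw [← this, hJ, intervalIntegral.integral_comp_add_left (fun x : ℝ => ‖P.eval (x:ℂ)‖^2)]
    congr 1
    push_cast
    rw [hNδ]; ring
  set W : ℝ := (2 * h / δ) ^ N / N.factorial with hW
  have hW0 : 0 ≤ W := by positivity
  have key : ∀ x ∈ Set.Icc a (a+h), ‖P.eval (x:ℂ)‖^2 * δ ≤ W^2 * J := by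
    intro x hx
    have hpt : ∀ s ∈ Set.Icc 0 δ, ‖P.eval (x:ℂ)‖^2 ≤ W^2 * ∑ i ∈ Finset.range (N+1),
      ‖P.eval ((a + h/8 + i * δ + s : ℝ):ℂ)‖^2 := by
      intro s hs
      set S := ∑ i ∈ Finset.range (N+1), ‖P.eval ((a + h/8 + i * δ + s : ℝ):ℂ)‖^2 with hS
      have hS0 : 0 ≤ S := Finset.sum_nonneg fun _ _ => by positivity
      have := aux_lagrange N P hP x (a + h/8 + s) δ h (Real.sqrt S) hδ hh.le ?_ ?_
      · calc _ ≤ (W * Real.sqrt S)^2 := by gcongr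
          _ = _ := by rw [mul_pow, Real.sq_sqrt hS0]
      · intro i hi
        have hi' : (i:ℝ) ≤ N := by
          have := Finset.mem_range.1 hi
          exact_mod_cast (by omega : i ≤ N)
        have h1 : i * δ ≤ N * δ := by gcongr
        have h2 : 0 ≤ i * δ := by positivity
        rw [abs_le]
        constructor <;> nlinarith [hx.1, hx.2, hs.1, hs.2]
      · intro i hi
        apply Real.le_sqrt_of_sq_le
        rw [show a + h/8 + s + i * δ = a + h/8 + i * δ + s by ring]
        exact Finset.single_le_sum (f := fun i : ℕ => ‖P.eval ((a + h/8 + i * δ + s : ℝ):ℂ)‖^2)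
          (fun _ _ => by positivity) hi
    have := intervalIntegral.integral_mono_on hδ.le (f := fun _ => ‖P.eval (x:ℂ)‖^2)
      (g := fun s => W^2 * ∑ i ∈ Finset.range (N+1), ‖P.eval ((a + h/8 + i * δ + s : ℝ):ℂ)‖^2)
      (μ := volume) (by simp)
      ((by fun_prop : Continuous _).intervalIntegrable _ _) hpt
    rw [intervalIntegral.integral_const_mul, ← hJs] at this
    simp only [intervalIntegral.integral_const, smul_eq_mul, sub_zero] at this
    linarith
  have hJ0 : 0 ≤ J := intervalIntegral.integral_nonneg (by linarith) fun _ _ => by positivity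
  have h2 : ∫ x in a..(a+h), ‖P.eval (x:ℂ)‖^2 ≤ ∫ x in a..(a+h), W^2 * J / δ := by
    refine intervalIntegral.integral_mono_on (by linarith) (hcont.intervalIntegrable _ _)
      (by simp) fun x hx => ?_
    rw [le_div_iff₀ hδ]; exact key x hx
  refine h2.trans ?_
  simp only [intervalIntegral.integral_const, smul_eq_mul, add_sub_cancel_left]
  have e1 : h / δ = 4 * (N+1) := by rw [hδd]; field_simp
  rw [show h * (W^2 * J / δ) = (h/δ) * W^2 * J by ring, e1]
  gcongr
  have e2 : W = 8^N * (((N:ℝ)+1)^N / N.factorial) := by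
    rw [hW, mul_div_assoc, e1, show 2 * (4 * ((N:ℝ)+1)) = 8 * (N+1) by ring, mul_pow]; ring
  have e3 : ((N:ℝ)+1)^N / N.factorial ≤ Real.exp (N+1) :=
    Real.pow_div_factorial_le_exp _ (by positivity) N
  have e4 : (8:ℝ) ≤ Real.exp (5/2) := by
    have := Real.exp_one_gt_d9
    have h5 : Real.exp (5/2) ^ 2 = Real.exp 1 ^ 5 := by
      rw [← Real.exp_nat_mul, ← Real.exp_nat_mul]; norm_num
    have h6 : (2.7:ℝ)^5 ≤ Real.exp 1 ^ 5 := by gcongr; linarith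
    by_contra hcon
    push Not at hcon
    have : Real.exp (5/2) ^ 2 < 8 ^ 2 := by gcongr
    rw [h5] at this
    have h7 : (8:ℝ)^2 < 2.7^5 := by norm_num
    linarith
  have e5 : (8:ℝ)^N ≤ Real.exp (N * (5/2)) := by
    rw [Real.exp_nat_mul]; gcongr
  have e6 : (N:ℝ) + 1 ≤ Real.exp N := Real.add_one_le_exp _
  have e7 : (4:ℝ) ≤ Real.exp 2 := by
    have := Real.exp_one_gt_d9
    have h5 : Real.exp 2 = Real.exp 1 ^ 2 := by
      rw [← Real.exp_nat_mul]; norm_num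
    rw [h5]; nlinarith
  calc 4 * ((N:ℝ)+1) * W^2 ≤ Real.exp 2 * Real.exp N *
        (Real.exp (N * (5/2)) * Real.exp (N+1))^2 := by
        rw [e2]; gcongr
    _ = Real.exp (4 + 8 * N) := by
      rw [← Real.exp_add, ← Real.exp_add, ← Real.exp_nat_mul, ← Real.exp_add]
      push_cast
      ring_nf

theorem aux_exp_diff (a b M : ℝ) (ha : a ≤ M) (hb : b ≤ M) :
    Real.exp (-M) * |a - b| ≤ |Real.exp (-a) - Real.exp (-b)| := by
  wlog hab : a ≤ b generalizing a b
  · rw [abs_sub_comm a, abs_sub_comm (Real.exp (-a))]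
    exact this b a hb ha (by linarith)
  have h1 : b - a + 1 ≤ Real.exp (b - a) := Real.add_one_le_exp _
  have h2 : Real.exp (-a) = Real.exp (-b) * Real.exp (b - a) := by
    rw [← Real.exp_add]; ring_nf
  have h3 : Real.exp (-M) ≤ Real.exp (-b) := Real.exp_le_exp.2 (by linarith)
  rw [abs_sub_comm, abs_of_nonneg (by linarith : 0 ≤ b - a)]
  refine le_trans ?_ (le_abs_self _)
  rw [h2]
  have := Real.exp_pos (-b)
  calc Real.exp (-M) * (b - a) ≤ Real.exp (-b) * (b - a) := by
        apply mul_le_mul_of_nonneg_right h3; linarith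
    _ ≤ Real.exp (-b) * (Real.exp (b-a) - 1) := by
        apply mul_le_mul_of_nonneg_left _ this.le; linarith
    _ = _ := by ring

/-- Lower bound for exponential sums with separated exponents. -/
theorem aux_low (m : ℕ) (hm : 1 ≤ m) (l : ℕ → ℝ) (a : ℕ → ℂ) (M d : ℝ) (hd : 0 ≤ d)
    (hl0 : ∀ j, 0 ≤ l j) (hlM : ∀ j ∈ Finset.range m, l j ≤ M)
    (hsep : ∀ j ∈ Finset.range m, ∀ k ∈ Finset.range m, k ≠ j → d ≤ |l j - l k|)
    (j : ℕ) (hj : j ∈ Finset.range m) :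
    (1/m) * (Real.exp (-M) * (Real.exp (-M) * d / (2 * m)) ^ (m-1))^2 * ‖a j‖^2 ≤
      ∫ t in (0:ℝ)..1, ‖∑ i ∈ Finset.range m, a i * ((Real.exp (-(t * l i)) : ℝ) : ℂ)‖^2 := by
  have hm0 : (0:ℝ) < m := by exact_mod_cast hm
  have hm1 : (1:ℝ) ≤ m := by exact_mod_cast hm
  set S : ℝ → ℂ := fun t => ∑ i ∈ Finset.range m, a i * ((Real.exp (-(t * l i)) : ℝ) : ℂ) with hS
  have hSc : Continuous S := by fun_prop
  set v : ℕ → ℝ := fun i => Real.exp (-(l i / m)) with hv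
  set q := Real.exp (-M) * d / (2 * m) with hq
  have hq0 : 0 ≤ q := by positivity
  have hM0 : 0 ≤ M := (hl0 j).trans (hlM j hj)
  have hle : ∀ {x : ℝ}, 0 ≤ x → x / m ≤ x := fun hx => div_le_self hx hm1
  have hcard : ((Finset.range m).erase j).card = m - 1 := by
    rw [Finset.card_erase_of_mem hj, Finset.card_range]
  have hpt : ∀ s ∈ Set.Icc (0:ℝ) (1/m), (Real.exp (-M) * q ^ (m-1))^2 * ‖a j‖^2 ≤
      ∑ i ∈ Finset.range m, ‖S (0 + i * (1/m) + s)‖^2 := by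
    intro s hs
    set R := ∑ i ∈ Finset.range m, ‖S (0 + i * (1/m) + s)‖^2 with hR
    have hR0 : 0 ≤ R := Finset.sum_nonneg fun _ _ => by positivity
    have hs1 : s ≤ 1 := hs.2.trans (hle zero_le_one)
    have h1 := aux_expsum v (fun i => ⟨(Real.exp_pos _).le, Real.exp_le_one_iff.2
        (by have := div_nonneg (hl0 i) hm0.le; linarith)⟩) j ((Finset.range m).erase j)
        (fun i => a i * ((Real.exp (-(s * l i)) : ℝ) : ℂ)) (Real.sqrt R)
        (Finset.notMem_erase _ _) ?_
    · have hprod : (2 * q) ^ (m-1) ≤ ∏ k ∈ (Finset.range m).erase j, |v j - v k| := by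
        rw [← hcard, ← Finset.prod_const]
        refine Finset.prod_le_prod (fun _ _ => by positivity) fun k hk => ?_
        have hk' := Finset.mem_of_mem_erase hk
        have h2 := aux_exp_diff (l j / m) (l k / m) M ((hle (hl0 j)).trans (hlM j hj))
          ((hle (hl0 k)).trans (hlM k hk'))
        refine le_trans ?_ h2
        rw [← sub_div, abs_div, abs_of_pos hm0, hq]
        have h3 := hsep j hj k hk' (Finset.ne_of_mem_erase hk)
        calc 2 * (Real.exp (-M) * d / (2 * m)) = Real.exp (-M) * (d / m) := by field_simp
          _ ≤ _ := by gcongr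
      rw [hcard, norm_mul, Complex.norm_real, Real.norm_eq_abs, abs_of_pos (Real.exp_pos _)] at h1
      have h4 : Real.exp (-M) ≤ Real.exp (-(s * l j)) := by
        apply Real.exp_le_exp.2
        have : s * l j ≤ 1 * l j := mul_le_mul_of_nonneg_right hs1 (hl0 j)
        have := hlM j hj
        linarith
      have h5 : ‖a j‖ * Real.exp (-M) * (2 * q) ^ (m-1) ≤ 2 ^ (m-1) * Real.sqrt R :=
        le_trans (by gcongr) h1
      have h6 : Real.exp (-M) * q ^ (m-1) * ‖a j‖ ≤ Real.sqrt R := by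
        rw [mul_pow] at h5
        refine le_of_mul_le_mul_left (a := (2:ℝ)^(m-1)) ?_ (by positivity)
        linarith
      rw [← mul_pow]
      calc _ ≤ (Real.sqrt R)^2 := by gcongr
        _ = R := Real.sq_sqrt hR0
    · intro i hi
      rw [hcard] at hi
      rw [Finset.insert_erase hj]
      have e : ∑ x ∈ Finset.range m, a x * ((Real.exp (-(s * l x)) : ℝ) : ℂ) * ((v x : ℝ) : ℂ) ^ i
          = S (0 + i * (1/m) + s) := by
        rw [hS]
        refine Finset.sum_congr rfl fun x _ => ?_
        rw [mul_assoc, ← Complex.ofReal_pow, ← Complex.ofReal_mul, hv]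
        simp only
        rw [← Real.exp_nat_mul, ← Real.exp_add]
        congr 3
        ring
      rw [e]
      apply Real.le_sqrt_of_sq_le
      exact Finset.single_le_sum (f := fun i : ℕ => ‖S (0 + i * (1/m) + s)‖^2)
          (fun _ _ => by positivity) (Finset.mem_range.2 (by omega))
  have hint := intervalIntegral.integral_mono_on (by positivity : (0:ℝ) ≤ 1/m)
    (f := fun _ => (Real.exp (-M) * q ^ (m-1))^2 * ‖a j‖^2)
    (g := fun s => ∑ i ∈ Finset.range m, ‖S (0 + i * (1/m) + s)‖^2)
    (μ := volume) (by simp) ((by fun_prop : Continuous _).intervalIntegrable _ _) hpt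
  rw [← aux_split (fun t => ‖S t‖^2) (by fun_prop) 0 (1/m) m] at hint
  simp only [intervalIntegral.integral_const, smul_eq_mul, sub_zero, zero_add] at hint
  rw [mul_one_div_cancel hm0.ne'] at hint
  calc _ = _ := by ring
    _ ≤ _ := hint

/-- Parseval identity for the aliased samples. -/
theorem aux_parseval (c : ℝ) (hc : 0 < c) (m : ℕ) (hm : 1 ≤ m) (H : ℝ → ℂ) (hH : Continuous H) :
    ∑' k : ℤ, ‖((1/(2*Real.pi) : ℝ) : ℂ) *
        ∫ ξ in (-c)..c, H ξ * Complex.exp (Complex.I * (((m:ℝ)*Real.pi/c*(k:ℝ) : ℝ) : ℂ) * ξ)‖^2 =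
      c / (2 * Real.pi^2 * m) *
        ∫ x in (0:ℝ)..(2*c/m), ‖∑ j ∈ Finset.range m, H (-c + j * (2*c/m) + x)‖^2 := by
  have hm0 : (0:ℝ) < m := by exact_mod_cast hm
  set h : ℝ := 2*c/m with hh
  have hh0 : 0 < h := by positivity
  have hmh : m * h = 2 * c := by rw [hh]; field_simp
  set G : ℝ → ℂ := fun x => ∑ j ∈ Finset.range m, H (-c + j * h + x) with hG
  have hGc : Continuous G := by fun_prop
  have hterm : ∀ k : ℤ, ‖((1/(2*Real.pi) : ℝ) : ℂ) *
        ∫ ξ in (-c)..c, H ξ * Complex.exp (Complex.I * (((m:ℝ)*Real.pi/c*(k:ℝ) : ℝ) : ℂ) * ξ)‖^2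
      = (h/(2*Real.pi))^2 * ‖fourierCoeffOn hh0 G (-k)‖^2 := by
    intro k
    have e1 := aux_split (fun ξ : ℝ => H ξ *
      Complex.exp (Complex.I * (((m:ℝ)*Real.pi/c*(k:ℝ) : ℝ) : ℂ) * ξ)) (by fun_prop) (-c) h m
    rw [hmh, show -c + 2 * c = c by ring] at e1
    have e2 : ∀ s : ℝ, ∑ i ∈ Finset.range m, H (-c + i * h + s) * Complex.exp (Complex.I *
        (((m:ℝ)*Real.pi/c*(k:ℝ) : ℝ) : ℂ) * ((-c + i * h + s : ℝ) : ℂ)) =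
        Complex.exp (((-(m * Real.pi * k) : ℝ) : ℂ) * Complex.I) *
          (Complex.exp (2 * π * Complex.I * k * s / h) * G s) := by
      intro s
      rw [hG, Finset.mul_sum, Finset.mul_sum]
      refine Finset.sum_congr rfl fun i _ => ?_
      have : Complex.exp (Complex.I *
        (((m:ℝ)*Real.pi/c*(k:ℝ) : ℝ) : ℂ) * ((-c + i * h + s : ℝ) : ℂ)) =
        Complex.exp (((-(m * Real.pi * k) : ℝ) : ℂ) * Complex.I) *
          Complex.exp (2 * π * Complex.I * k * s / h) := by
        rw [← Complex.exp_add, Complex.exp_eq_exp_iff_exists_int]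
        refine ⟨k * i, ?_⟩
        rw [hh]
        have h1 : (c:ℂ) ≠ 0 := by exact_mod_cast hc.ne'
        have h2 : (m:ℂ) ≠ 0 := by exact_mod_cast hm0.ne'
        push_cast
        field_simp
        ring
      rw [this]; ring
    simp only [e2] at e1
    rw [e1, intervalIntegral.integral_const_mul, fourierCoeffOn_eq_integral]
    simp only [neg_neg, fourier_coe_apply, sub_zero, smul_eq_mul]
    rw [norm_mul, norm_mul, Complex.norm_exp_ofReal_mul_I, norm_smul, Complex.norm_real,
      Real.norm_eq_abs, Real.norm_eq_abs, abs_of_pos (by positivity), abs_of_pos (by positivity)]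
    field_simp
  simp only [hterm]
  have hneg := (Equiv.neg ℤ).tsum_eq (fun k => ‖fourierCoeffOn hh0 G k‖^2)
  simp only [Equiv.neg_apply] at hneg
  rw [tsum_mul_left, hneg]
  rw [tsum_sq_fourierCoeffOn hh0 ?_]
  · simp only [sub_zero, smul_eq_mul]
    rw [← mul_assoc]
    congr 1
    rw [hh]; field_simp
  · refine (memLp_two_iff_integrable_sq_norm hGc.aestronglyMeasurable).2 ?_
    exact (by fun_prop : Continuous fun x => ‖G x‖^2).integrableOn_Ioc

theorem aux_numeric (c : ℝ) (hc : 0 < c) (σ : ℝ) (hσ : σ ≠ 0) (m : ℕ) (hm : 2 ≤ m) (N : ℕ) :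
    (c*(Real.exp (-4) / (2 * Real.pi^2))/((σ*c)^2+(m:ℝ))) *
      Real.exp (-(8*(N:ℝ)) - (m:ℝ)^2*(-(2*Real.log |σ|) +
        (Real.exp (2 * (10 + 4 * |Real.log c|)) + 2 * c^2)*σ^2 + Real.log (m:ℝ))) ≤
    c / (2 * Real.pi^2 * m) * (1 / m) * ((1/m) * (Real.exp (-(σ^2*c^2)) *
      (Real.exp (-(σ^2*c^2)) * (σ^2*c^2/m^2) / (2 * m)) ^ (m-1))^2) * Real.exp (-(4 + 8 * N)) := by
  have hm0 : (0:ℝ) < m := by exact_mod_cast (by omega : 0 < m)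
  have hm2 : (2:ℝ) ≤ m := by exact_mod_cast hm
  have hs0 : 0 < |σ| := abs_pos.2 hσ
  set A := 10 + 4 * |Real.log c| with hA
  have hA0 : 0 ≤ A := by positivity
  set L := Real.log |σ| with hL
  set lm := Real.log (m:ℝ) with hlm
  have e1 : (1:ℝ) / m^2 = Real.exp (-2 * lm) := by
    rw [show -2 * lm = -((2:ℕ) * lm) by push_cast; ring, Real.exp_neg, Real.exp_nat_mul,
      Real.exp_log hm0]; simp
  have e2 : Real.exp (-(σ^2*c^2)) * (σ^2*c^2/m^2) / (2 * m) =
      Real.exp (-(σ^2*c^2) + 2 * L + 2 * Real.log c - Real.log 2 - 3 * lm) := by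
    rw [Real.exp_sub, Real.exp_sub, Real.exp_add, Real.exp_add,
      show 2 * L = (2:ℕ) * L by norm_num, show 2 * Real.log c = (2:ℕ) * Real.log c by norm_num,
      show 3 * lm = (3:ℕ) * lm by norm_num, Real.exp_nat_mul, Real.exp_nat_mul, Real.exp_nat_mul,
      hL, hlm, Real.exp_log hs0, Real.exp_log hc, Real.exp_log hm0,
      Real.exp_log (by norm_num : (0:ℝ) < 2), sq_abs]
    field_simp
  have hm1 : ((m - 1 : ℕ) : ℝ) = m - 1 := by rw [Nat.cast_sub (by omega)]; simp
  have key : Real.exp (- (m:ℝ)^2*(-(2*L) + (Real.exp (2 * A) + 2 * c^2)*σ^2 + lm)) ≤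
      1 / m^2 * (Real.exp (-(σ^2*c^2)) *
      (Real.exp (-(σ^2*c^2)) * (σ^2*c^2/m^2) / (2 * m)) ^ (m-1))^2 := by
    rw [e1, e2, ← Real.exp_nat_mul, ← Real.exp_add, ← Real.exp_nat_mul, ← Real.exp_add, hm1]
    apply Real.exp_le_exp.2
    push_cast
    have hL1 : L ≤ Real.exp (2*A) * σ^2 / 2 - A := by
      have h1 : Real.log (Real.exp (2*A) * |σ|^2) ≤ Real.exp (2*A) * |σ|^2 - 1 :=
        Real.log_le_sub_one_of_pos (by positivity)
      rw [Real.log_mul (by positivity) (by positivity), Real.log_exp, Real.log_pow, sq_abs] at h1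
      push_cast at h1
      linarith
    have hlm0 : 0 ≤ lm := Real.log_nonneg (by linarith)
    have hlm1 : lm ≤ m := (Real.log_le_sub_one_of_pos hm0).trans (by linarith)
    have hlc : -Real.log c ≤ |Real.log c| := neg_le_abs _
    have hl2 : Real.log 2 ≤ 1 := (Real.log_le_sub_one_of_pos (by norm_num)).trans (by norm_num)
    set s := Real.exp (2*A) with hs
    have hsp : 0 ≤ s * σ^2 := by positivity
    have hmm : (m:ℝ) ≤ m^2 := by nlinarith
    -- main estimate on the logarithm of `σ`
    have b1 : (2*(m:ℝ)^2 - 4*(m-1)) * L ≤ m^2 * (s * σ^2) - A * m^2 := by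
      have hq1 : (m:ℝ)^2 ≤ 2*(m:ℝ)^2 - 4*(m-1) := by nlinarith [sq_nonneg ((m:ℝ)-2)]
      have hq2 : 2*(m:ℝ)^2 - 4*(m-1) ≤ 2 * m^2 := by linarith
      calc _ ≤ (2*(m:ℝ)^2 - 4*(m-1)) * (s * σ^2 / 2 - A) :=
            mul_le_mul_of_nonneg_left hL1 (by nlinarith)
        _ ≤ _ := by nlinarith [mul_le_mul_of_nonneg_right hq2 hsp, mul_le_mul_of_nonneg_right hq1 hA0]
    have b2 : 2 * (m:ℝ) * (σ^2*c^2) ≤ 2 * m^2 * (σ^2*c^2) := by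
      have : 0 ≤ σ^2*c^2 := by positivity
      nlinarith
    have b3 : -4 * ((m:ℝ)-1) * Real.log c ≤ 4 * m^2 * |Real.log c| := by
      have h0 := abs_nonneg (Real.log c)
      have h1 : ((m:ℝ)-1) * (-Real.log c) ≤ ((m:ℝ)-1) * |Real.log c| :=
        mul_le_mul_of_nonneg_left hlc (by linarith)
      nlinarith
    have b4 : 2 * ((m:ℝ)-1) * Real.log 2 ≤ 2 * m^2 := by nlinarith
    have b5 : 6 * ((m:ℝ)-1) * lm ≤ m^2 * lm + 3 * lm := by
      nlinarith [mul_nonneg (sq_nonneg ((m:ℝ)-3)) hlm0]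
    have b6 : A * m^2 = 10 * m^2 + 4 * m^2 * |Real.log c| := by rw [hA]; ring
    nlinarith
  have hden : c*(Real.exp (-4) / (2 * Real.pi^2))/((σ*c)^2+(m:ℝ)) ≤
      c*(Real.exp (-4) / (2 * Real.pi^2))/m := by
    apply div_le_div_of_nonneg_left (by positivity) hm0
    have := sq_nonneg (σ*c)
    linarith
  have hexp : Real.exp (-(8*(N:ℝ)) - (m:ℝ)^2*(-(2*L) + (Real.exp (2 * A) + 2 * c^2)*σ^2 + lm)) =
      Real.exp (-(8*(N:ℝ))) *
        Real.exp (- (m:ℝ)^2*(-(2*L) + (Real.exp (2 * A) + 2 * c^2)*σ^2 + lm)) := by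
    rw [← Real.exp_add]; ring_nf
  rw [hexp, show -(4 + 8 * (N:ℝ)) = -4 + -(8*(N:ℝ)) by ring, Real.exp_add]
  calc _ ≤ c*(Real.exp (-4) / (2 * Real.pi^2))/m * (Real.exp (-(8*(N:ℝ))) * (1 / m^2 *
      (Real.exp (-(σ^2*c^2)) * (Real.exp (-(σ^2*c^2)) * (σ^2*c^2/m^2) / (2 * m)) ^ (m-1))^2)) := by
        gcongr
    _ = _ := by
      generalize (Real.exp (-(σ^2*c^2)) *
        (Real.exp (-(σ^2*c^2)) * (σ^2*c^2/m^2) / (2 * m)) ^ (m-1))^2 = X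
      field_simp

/-- The space-time integral identity for the samples. -/
theorem aux_samples (c : ℝ) (hc : 0 < c) (σ : ℝ) (m : ℕ) (hm : 1 ≤ m) (P : Polynomial ℂ) (t : ℝ) :
    ∑' k : ℤ, ‖heatSample c (GaussHat σ)
        (Set.indicator (Set.Icc (-c) c) (fun x : ℝ => Polynomial.eval (x:ℂ) P))
        t ((m:ℝ)*Real.pi/c*(k:ℝ))‖^2 =
      c / (2 * Real.pi^2 * m) *
        ∫ x in (0:ℝ)..(2*c/m), ‖∑ j ∈ Finset.range m,
          P.eval ((-c + j * (2*c/m) + x : ℝ) : ℂ) *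
            ((Real.exp (-(t * (σ^2 * (-c + j * (2*c/m) + x)^2))) : ℝ) : ℂ)‖^2 := by
  rw [← aux_parseval c hc m hm
    (fun x => P.eval (x : ℂ) * ((Real.exp (-(t * (σ^2 * x^2))) : ℝ) : ℂ)) (by fun_prop)]
  refine tsum_congr fun k => ?_
  rw [heatSample]
  congr 3
  refine intervalIntegral.integral_congr fun ξ hξ => ?_
  rw [Set.uIcc_of_le (by linarith)] at hξ
  simp only [Set.indicator_of_mem hξ]
  congr 3
  rw [GaussHat, ← Real.exp_mul]
  ring_nf

theorem aux_norm_int (c : ℝ) (hc : 0 < c) (P : Polynomial ℂ) :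
    ∫ ξ : ℝ, ‖Set.indicator (Set.Icc (-c) c) (fun x : ℝ => Polynomial.eval (x:ℂ) P) ξ‖^2 =
      ∫ x in (-c)..c, ‖P.eval (x:ℂ)‖^2 := by
  rw [intervalIntegral.integral_of_le (by linarith), ← integral_Icc_eq_integral_Ioc,
    ← integral_indicator measurableSet_Icc]
  congr 1
  ext ξ
  by_cases h : ξ ∈ Set.Icc (-c) c
  · simp [h]
  · simp [h]

theorem aux_sep (c : ℝ) (hc : 0 < c) (σ : ℝ) (m : ℕ) (hm : 1 ≤ m) (x : ℝ)
    (hx : x ∈ Set.Icc (2*c/m/8) (3*(2*c/m)/8)) (j k : ℕ) (hjk : k ≠ j) :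
    σ^2 * c^2 / m^2 ≤ |σ^2 * (-c + j * (2*c/m) + x)^2 - σ^2 * (-c + k * (2*c/m) + x)^2| := by
  have hm0 : (0:ℝ) < m := by exact_mod_cast hm
  set h : ℝ := 2*c/m with hh
  have hh0 : 0 < h := by positivity
  have hmh : m * h = 2 * c := by rw [hh]; field_simp
  have e : σ^2 * (-c + j * h + x)^2 - σ^2 * (-c + k * h + x)^2 =
      σ^2 * ((((j:ℤ) - k : ℤ) : ℝ) * h) * (2 * x + (((j:ℤ) + k - m : ℤ) : ℝ) * h) := by
    push_cast
    have : c = m * h / 2 := by linarith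
    rw [this]; ring
  rw [e, abs_mul, abs_mul, abs_of_nonneg (sq_nonneg σ), abs_mul, abs_of_pos hh0]
  have h1 : (1:ℝ) ≤ |(((j:ℤ) - k : ℤ) : ℝ)| := by
    have : (1:ℤ) ≤ |(j:ℤ) - k| := Int.one_le_abs (by omega)
    exact_mod_cast this
  have h2 : h / 4 ≤ |2 * x + (((j:ℤ) + k - m : ℤ) : ℝ) * h| := by
    generalize ((j:ℤ) + k - m : ℤ) = z
    rcases le_or_gt 0 z with hz | hz
    · have : (0:ℝ) ≤ z := by exact_mod_cast hz
      refine le_trans ?_ (le_abs_self _)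
      nlinarith [hx.1]
    · have : (z:ℝ) ≤ -1 := by exact_mod_cast (by omega : z ≤ -1)
      refine le_trans ?_ (neg_le_abs _)
      nlinarith [hx.2]
  calc σ^2 * c^2 / m^2 = σ^2 * (1 * h) * (h/4) := by rw [hh]; field_simp; ring
    _ ≤ _ := by gcongr

set_option maxHeartbeats 2000000 in
/-- Theorem `thm:gauss_body` for the model `V_N` of Fourier polynomials. -/
theorem stmt10 (c : ℝ) (hc : 0 < c) :
    ∃ κ₀ κ₁ κ₂ κ₃ : ℝ, 0 < κ₀ ∧ 0 < κ₁ ∧ 0 < κ₂ ∧ 0 < κ₃ ∧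
      ∀ σ : ℝ, σ ≠ 0 → ∀ m : ℕ, 2 ≤ m → ∀ N : ℕ,
        ∀ P : Polynomial ℂ, P.natDegree ≤ N →
          (c*κ₀/((σ*c)^2+(m:ℝ))) *
              Real.exp (-(κ₁*(N:ℝ)) -
                (m:ℝ)^2*(-(κ₂*Real.log |σ|) + κ₃*σ^2 + Real.log (m:ℝ))) *
              (∫ ξ : ℝ, ‖Set.indicator (Set.Icc (-c) c)
                  (fun x : ℝ => Polynomial.eval (x:ℂ) P) ξ‖^2)
            ≤ ∫ t in (0:ℝ)..1, ∑' k : ℤ,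
                ‖heatSample c (GaussHat σ)
                    (Set.indicator (Set.Icc (-c) c) (fun x : ℝ => Polynomial.eval (x:ℂ) P))
                    t ((m:ℝ)*Real.pi/c*(k:ℝ))‖^2
          ∧ ∫ t in (0:ℝ)..1, ∑' k : ℤ,
                ‖heatSample c (GaussHat σ)
                    (Set.indicator (Set.Icc (-c) c) (fun x : ℝ => Polynomial.eval (x:ℂ) P))
                    t ((m:ℝ)*Real.pi/c*(k:ℝ))‖^2
            ≤ c/(2*Real.pi^2) *
                ∫ ξ : ℝ, ‖Set.indicator (Set.Icc (-c) c)
                    (fun x : ℝ => Polynomial.eval (x:ℂ) P) ξ‖^2 := by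
  refine ⟨Real.exp (-4) / (2 * Real.pi^2), 8, 2, Real.exp (2 * (10 + 4 * |Real.log c|)) + 2 * c^2,
    by positivity, by norm_num, by norm_num, by positivity, ?_⟩
  intro σ hσ m hm N P hP
  have hm1 : 1 ≤ m := by omega
  have hm0 : (0:ℝ) < m := by exact_mod_cast hm1
  rw [aux_norm_int c hc P]
  simp only [aux_samples c hc σ m hm1 P]
  rw [intervalIntegral.integral_const_mul]
  set h : ℝ := 2*c/m with hh
  have hh0 : 0 < h := by positivity
  have hmh : m * h = 2 * c := by rw [hh]; field_simp
  set G : ℝ → ℝ → ℝ := fun t x => ‖∑ j ∈ Finset.range m,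
          P.eval ((-c + j * h + x : ℝ) : ℂ) *
            ((Real.exp (-(t * (σ^2 * (-c + j * h + x)^2))) : ℝ) : ℂ)‖^2 with hG
  have hGc : Continuous (Function.uncurry G) := by
    rw [hG]; unfold Function.uncurry; fun_prop
  have hsplit : ∫ x in (-c)..c, ‖P.eval (x:ℂ)‖^2 =
      ∫ x in (0:ℝ)..h, ∑ j ∈ Finset.range m, ‖P.eval ((-c + j * h + x : ℝ) : ℂ)‖^2 := by
    have := aux_split (fun x : ℝ => ‖P.eval (x:ℂ)‖^2) (by fun_prop) (-c) h m
    rw [hmh, show -c + 2 * c = c by ring] at this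
    exact this
  have hpos : 0 ≤ c / (2 * Real.pi^2 * m) := by positivity
  have hIc : Continuous fun t => ∫ x in (0:ℝ)..h, G t x :=
    intervalIntegral.continuous_parametric_intervalIntegral_of_continuous' hGc 0 h
  constructor
  · have hswap : ∫ t in (0:ℝ)..1, ∫ x in (0:ℝ)..h, G t x =
        ∫ x in (0:ℝ)..h, ∫ t in (0:ℝ)..1, G t x := by
      apply intervalIntegral_intervalIntegral_swap
      rw [Set.uIoc_of_le zero_le_one, Set.uIoc_of_le hh0.le]
      have h1 : IntegrableOn (Function.uncurry G) (Set.Icc 0 1 ×ˢ Set.Icc 0 h) :=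
        hGc.continuousOn.integrableOn_compact (isCompact_Icc.prod isCompact_Icc)
      exact h1.mono_set (Set.prod_mono Set.Ioc_subset_Icc_self Set.Ioc_subset_Icc_self)
    have hGc' : Continuous (Function.uncurry fun x t => G t x) := by
      rw [hG]; unfold Function.uncurry; fun_prop
    have hIc' : Continuous fun x => ∫ t in (0:ℝ)..1, G t x :=
      intervalIntegral.continuous_parametric_intervalIntegral_of_continuous' hGc' 0 1
    set q : ℝ := (1/m) * (Real.exp (-(σ^2*c^2)) *
      (Real.exp (-(σ^2*c^2)) * (σ^2*c^2/m^2) / (2 * m)) ^ (m-1))^2 with hq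
    have hq0 : 0 ≤ q := by positivity
    have hlow : ∀ x ∈ Set.Icc (h/8) (3*h/8),
        (1/m) * q * ∑ j ∈ Finset.range m, ‖P.eval ((-c + j * h + x : ℝ) : ℂ)‖^2 ≤
          ∫ t in (0:ℝ)..1, G t x := by
      intro x hx
      have hj : ∀ j ∈ Finset.range m, q * ‖P.eval ((-c + j * h + x : ℝ) : ℂ)‖^2 ≤
          ∫ t in (0:ℝ)..1, G t x := by
        intro j hj
        refine aux_low m hm1 (fun j => σ^2 * (-c + j * h + x)^2)
          (fun j => P.eval ((-c + j * h + x : ℝ) : ℂ)) (σ^2*c^2) (σ^2*c^2/m^2) (by positivity)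
          (fun j => by positivity) ?_ ?_ j hj
        · intro i hi
          have hi' : (i:ℝ) + 1 ≤ m := by exact_mod_cast Finset.mem_range.1 hi
          have h1 : ((i:ℝ) + 1) * h ≤ m * h := by gcongr
          have h2 : 0 ≤ i * h := by positivity
          have h3 : (-c + i * h + x)^2 ≤ c^2 := by
            apply sq_le_sq'
            · linarith [hx.1]
            · linarith [hx.2]
          show σ^2 * (-c + i * h + x)^2 ≤ σ^2 * c^2
          gcongr
        · intro i _ k _ hik
          exact aux_sep c hc σ m hm1 x hx i k hik
      have := Finset.sum_le_sum hj
      rw [← Finset.mul_sum, Finset.sum_const, Finset.card_range, nsmul_eq_mul] at this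
      rw [mul_assoc, one_div, inv_mul_le_iff₀ hm0]
      exact this
    have hG0 : ∀ x, 0 ≤ ∫ t in (0:ℝ)..1, G t x := fun x =>
      intervalIntegral.integral_nonneg zero_le_one fun _ _ => by positivity
    have h1 : ∫ x in (h/8)..(3*h/8), ∫ t in (0:ℝ)..1, G t x ≤
        ∫ x in (0:ℝ)..h, ∫ t in (0:ℝ)..1, G t x :=
      intervalIntegral.integral_mono_interval (by linarith) (by linarith) (by linarith)
        (Filter.Eventually.of_forall hG0) (hIc'.intervalIntegrable _ _)
    have h2 : (1/m) * q * ∫ x in (h/8)..(3*h/8),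
        ∑ j ∈ Finset.range m, ‖P.eval ((-c + j * h + x : ℝ) : ℂ)‖^2 ≤
        ∫ x in (h/8)..(3*h/8), ∫ t in (0:ℝ)..1, G t x := by
      rw [← intervalIntegral.integral_const_mul]
      exact intervalIntegral.integral_mono_on (by linarith)
        ((by fun_prop : Continuous _).intervalIntegrable _ _) (hIc'.intervalIntegrable _ _) hlow
    have h3 : Real.exp (-(4 + 8 * N)) * ∫ x in (-c)..c, ‖P.eval (x:ℂ)‖^2 ≤
        ∫ x in (h/8)..(3*h/8),
        ∑ j ∈ Finset.range m, ‖P.eval ((-c + j * h + x : ℝ) : ℂ)‖^2 := by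
      rw [Real.exp_neg, inv_mul_le_iff₀ (Real.exp_pos _), hsplit,
        intervalIntegral.integral_finsetSum
          (f := fun (j : ℕ) (x : ℝ) => ‖P.eval ((-c + j * h + x : ℝ) : ℂ)‖^2)
          (fun i _ => (by fun_prop : Continuous _).intervalIntegrable _ _),
        intervalIntegral.integral_finsetSum
          (f := fun (j : ℕ) (x : ℝ) => ‖P.eval ((-c + j * h + x : ℝ) : ℂ)‖^2)
          (fun i _ => (by fun_prop : Continuous _).intervalIntegrable _ _), Finset.mul_sum]
      refine Finset.sum_le_sum fun j _ => ?_
      have := aux_remez N P hP (-c + j * h) h hh0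
      rw [intervalIntegral.integral_comp_add_left (fun x : ℝ => ‖P.eval (x:ℂ)‖^2), add_zero]
      exact this
    have hnum := aux_numeric c hc σ hσ m hm N
    have hI0 : 0 ≤ ∫ x in (-c)..c, ‖P.eval (x:ℂ)‖^2 :=
      intervalIntegral.integral_nonneg (by linarith) fun _ _ => by positivity
    refine (mul_le_mul_of_nonneg_right hnum hI0).trans ?_
    rw [hswap]
    calc _ = c / (2 * Real.pi^2 * m) * ((1/m) * q *
          (Real.exp (-(4 + 8 * N)) * ∫ x in (-c)..c, ‖P.eval (x:ℂ)‖^2)) := by rw [hq]; ring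
      _ ≤ c / (2 * Real.pi^2 * m) * ((1/m) * q * ∫ x in (h/8)..(3*h/8),
        ∑ j ∈ Finset.range m, ‖P.eval ((-c + j * h + x : ℝ) : ℂ)‖^2) := by gcongr
      _ ≤ _ := mul_le_mul_of_nonneg_left (h2.trans h1) hpos
  · have hup : ∀ t ∈ Set.Icc (0:ℝ) 1, ∫ x in (0:ℝ)..h, G t x ≤
        m * ∫ x in (-c)..c, ‖P.eval (x:ℂ)‖^2 := by
      intro t ht
      rw [hsplit, ← intervalIntegral.integral_const_mul]
      refine intervalIntegral.integral_mono_on hh0.le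
        ((by rw [hG]; fun_prop : Continuous (G t)).intervalIntegrable _ _)
        ((by fun_prop : Continuous _).intervalIntegrable _ _) fun x _ => ?_
      have h1 : ‖∑ j ∈ Finset.range m, P.eval ((-c + j * h + x : ℝ) : ℂ) *
            ((Real.exp (-(t * (σ^2 * (-c + j * h + x)^2))) : ℝ) : ℂ)‖ ≤
          ∑ j ∈ Finset.range m, ‖P.eval ((-c + j * h + x : ℝ) : ℂ)‖ := by
        refine (norm_sum_le _ _).trans (Finset.sum_le_sum fun j _ => ?_)
        rw [norm_mul, Complex.norm_real, Real.norm_eq_abs, abs_of_pos (Real.exp_pos _)]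
        refine mul_le_of_le_one_right (norm_nonneg _) (Real.exp_le_one_iff.2 ?_)
        have : 0 ≤ t * (σ^2 * (-c + j * h + x)^2) := mul_nonneg ht.1 (by positivity)
        linarith
      have h2 := sq_sum_le_card_mul_sum_sq (s := Finset.range m)
        (f := fun j : ℕ => ‖P.eval ((-c + j * h + x : ℝ) : ℂ)‖)
      rw [Finset.card_range] at h2
      exact (pow_le_pow_left₀ (norm_nonneg _) h1 2).trans h2
    have h3 := intervalIntegral.integral_mono_on zero_le_one (hIc.intervalIntegrable 0 1)
      (by simp : IntervalIntegrable (fun _ : ℝ => m * ∫ x in (-c)..c, ‖P.eval (x:ℂ)‖^2) volume 0 1)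
      hup
    simp only [intervalIntegral.integral_const, smul_eq_mul, sub_zero, one_mul] at h3
    refine (mul_le_mul_of_nonneg_left h3 hpos).trans (le_of_eq ?_)
    field_simp
end
end

section
/- Let c > 0. There exist positive constants κ₀, κ₁, κ₂, κ₃ depending only on c with the following property: for every σ ≠ 0, every integer m ≥ 2, every N ∈ ℕ with N ≥ 1, and every f of the form f(x) = Σ_{n=1}^N a_n sinc(c(x−λ_n)) with a_1,…,a_N ∈ ℂ and λ_1,…,λ_N ∈ ℝ, one has κ·‖f̂‖²_{L²} ≤ ∫₀¹ Σ_{k∈ℤ} |f_t(mπk/c)|² dt ≤ (c/(2π²))·‖f̂‖²_{L²}, where κ = (c·κ₀/((σc)²+m)) · exp(−κ₁N − m²(−κ₂ ln|σ| + κ₃σ² + ln m)) and f_t is the heat flow of f with kernel φ̂(ξ) = e^{−σ²ξ²}. -/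
open MeasureTheory Matrix
open scoped Real BigOperators

noncomputable section

/-- `φ` is a polynomial with exponents in `[a,b]` and coefficient `ℓ¹` norm at most `B`. -/
def PolyRep (a b : ℕ) (B : ℝ) (φ : ℂ → ℂ) : Prop :=
  ∃ (ι : Type) (_ : Fintype ι) (u : ι → ℂ) (k : ι → ℕ),
    (∀ i, a ≤ k i ∧ k i ≤ b) ∧ (∀ z, φ z = ∑ i, u i * z ^ k i) ∧ ∑ i, ‖u i‖ ≤ B

lemma PolyRep.mono {a b a' b' : ℕ} {B B' : ℝ} {φ : ℂ → ℂ} (h : PolyRep a b B φ)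
    (ha : a' ≤ a) (hb : b ≤ b') (hB : B ≤ B') : PolyRep a' b' B' φ := by
  obtain ⟨ι, _, u, k, h1, h2, h3⟩ := h
  exact ⟨ι, _, u, k, fun i => ⟨ha.trans (h1 i).1, (h1 i).2.trans hb⟩, h2, h3.trans hB⟩

lemma PolyRep.monomial (u : ℂ) (k : ℕ) : PolyRep k k ‖u‖ (fun z => u * z ^ k) :=
  ⟨Unit, inferInstance, fun _ => u, fun _ => k, by simp, by simp, by simp⟩

lemma PolyRep.zero (a b : ℕ) : PolyRep a b 0 (fun _ => 0) :=
  ⟨Empty, inferInstance, fun _ => 0, fun _ => 0, by simp, by simp, by simp⟩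

lemma PolyRep.add {a b : ℕ} {B B' : ℝ} {φ ψ : ℂ → ℂ} (h : PolyRep a b B φ) (h' : PolyRep a b B' ψ) :
    PolyRep a b (B + B') (fun z => φ z + ψ z) := by
  obtain ⟨ι, _, u, k, h1, h2, h3⟩ := h
  obtain ⟨ι', _, u', k', h1', h2', h3'⟩ := h'
  refine ⟨ι ⊕ ι', inferInstance, Sum.elim u u', Sum.elim k k', ?_, ?_, ?_⟩
  · rintro (i | i)
    · exact h1 i
    · exact h1' i
  · intro z
    simp [h2, h2']
  · simp
    linarith

lemma PolyRep.shift {a b : ℕ} {B : ℝ} {φ : ℂ → ℂ} (h : PolyRep a b B φ) (v : ℂ) (n : ℕ) :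
    PolyRep (a + n) (b + n) (‖v‖ * B) (fun z => v * z ^ n * φ z) := by
  obtain ⟨ι, _, u, k, h1, h2, h3⟩ := h
  refine ⟨ι, inferInstance, fun i => v * u i, fun i => k i + n, ?_, ?_, ?_⟩
  · intro i
    exact ⟨Nat.add_le_add_right (h1 i).1 n, Nat.add_le_add_right (h1 i).2 n⟩
  · intro z
    simp only [h2, Finset.mul_sum]
    refine Finset.sum_congr rfl fun i _ => ?_
    ring
  · simp only [norm_mul, ← Finset.mul_sum]
    exact mul_le_mul_of_nonneg_left h3 (norm_nonneg v)

lemma PolyRep.nonneg {a b : ℕ} {B : ℝ} {φ : ℂ → ℂ} (h : PolyRep a b B φ) : 0 ≤ B := by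
  obtain ⟨ι, _, u, k, h1, h2, h3⟩ := h
  exact (Finset.sum_nonneg fun i _ => norm_nonneg _).trans h3

/-- Product `∏ (z - v_k)`. -/
lemma PolyRep.prod {ι : Type} (s : Finset ι) (v : ι → ℂ) (hv : ∀ i, ‖v i‖ ≤ 1) :
    PolyRep 0 s.card (2 ^ s.card) (fun z => ∏ i ∈ s, (z - v i)) := by
  classical
  induction s using Finset.induction_on with
  | empty => simpa using PolyRep.monomial 1 0
  | insert i s hi ih =>
    have h1 := (ih.shift 1 1).mono (a' := 0) (b' := s.card + 1) (B' := 2 ^ s.card)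
      (by omega) le_rfl (by simp)
    have h2 := (ih.shift (-v i) 0).mono (a' := 0) (b' := s.card + 1) (B' := 2 ^ s.card)
      (by omega) (by omega) (by
        rw [norm_neg]
        have := mul_le_mul_of_nonneg_right (hv i) (pow_nonneg zero_le_two s.card : (0:ℝ) ≤ 2 ^ s.card)
        linarith)
    have h3 := h1.add h2
    rw [Finset.card_insert_of_notMem hi]
    convert h3 using 1
    · ring
    · funext z
      rw [Finset.prod_insert hi]
      ring

lemma turan_poly (N : ℕ) : ∀ (z : Fin N → ℂ), (∀ j, ‖z j‖ = 1) → ∀ M : ℕ,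
    ∃ φ : ℂ → ℂ, PolyRep (M + 1) (M + N) (5 ^ N * 2 ^ M) φ ∧ ∀ j, φ (z j) = 1 := by
  induction N with
  | zero =>
    intro z hz M
    exact ⟨fun _ => 0, (PolyRep.zero _ _).mono le_rfl le_rfl (by positivity), fun j => j.elim0⟩
  | succ N ih =>
    intro z hz M
    set w := z (Fin.last N) with hw
    have hw1 : ‖w‖ = 1 := hz _
    have hw0 : w ≠ 0 := by
      intro h
      simp [h] at hw1
    have ih' := ih (fun j => z j.castSucc) (fun j => hz _)
    have hD : ∀ M : ℕ, ∃ D : ℂ → ℂ, PolyRep (M + 1) (M + N) (2 * (5 ^ N * 2 ^ M)) D ∧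
        ∀ j : Fin N, (1 - w⁻¹ * z j.castSucc) * D (z j.castSucc)
          = 1 - (w⁻¹ * z j.castSucc) ^ (M + 1) := by
      intro M
      induction M with
      | zero =>
        obtain ⟨φ, h1, h2⟩ := ih' 0
        refine ⟨φ, h1.mono le_rfl le_rfl ?_, ?_⟩
        · have : (0:ℝ) ≤ 5 ^ N * 2 ^ 0 := by positivity
          linarith
        · intro j
          rw [h2 j]
          ring
      | succ M ihM =>
        obtain ⟨D, hD1, hD2⟩ := ihM
        obtain ⟨φ, h1, h2⟩ := ih' (M + 1)
        refine ⟨fun x => φ x + w⁻¹ * x ^ 1 * D x, ?_, ?_⟩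
        · have h3 := (hD1.shift w⁻¹ 1).mono (a' := M + 1 + 1) (b' := M + 1 + N)
            (B' := 2 * (5 ^ N * 2 ^ M)) (by omega) (by omega) (by simp [hw1])
          refine (h1.add h3).mono le_rfl le_rfl (le_of_eq ?_)
          ring
        · intro j
          have h4 := hD2 j
          have h5 := h2 j
          beta_reduce
          rw [h5]
          linear_combination (w⁻¹ * z j.castSucc) * h4
    obtain ⟨D, hD1, hD2⟩ := hD M
    refine ⟨fun x => w⁻¹ ^ (M + 1) * x ^ (M + 1) + (D x + (-w⁻¹) * x ^ 1 * D x), ?_, ?_⟩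
    · have h1 := (PolyRep.monomial (w⁻¹ ^ (M + 1)) (M + 1)).mono (a' := M + 1) (b' := M + (N + 1))
        (B' := 1) le_rfl (by omega) (by simp [hw1])
      have h2 := hD1.mono (a' := M + 1) (b' := M + (N + 1)) le_rfl (by omega) le_rfl
      have h3 := (hD1.shift (-w⁻¹) 1).mono (a' := M + 1) (b' := M + (N + 1))
        (B' := 2 * (5 ^ N * 2 ^ M)) (by omega) (by omega) (by simp [hw1])
      refine (h1.add (h2.add h3)).mono le_rfl le_rfl ?_
      have : (1:ℝ) ≤ 5 ^ N * 2 ^ M := by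
        have h5 : (1:ℝ) ≤ 5 ^ N := one_le_pow₀ (by norm_num)
        have h6 : (1:ℝ) ≤ 2 ^ M := one_le_pow₀ (by norm_num)
        nlinarith
      rw [pow_succ]
      linarith
    · intro j
      refine Fin.lastCases ?_ (fun j => ?_) j
      · simp only [← hw]
        rw [← mul_pow, inv_mul_cancel₀ hw0]
        field_simp
        simp
      · have := hD2 j
        linear_combination this

lemma norm_sum_sq_le {ι : Type} [Fintype ι] (u w : ι → ℂ) :
    ‖∑ i, u i * w i‖ ^ 2 ≤ (∑ i, ‖u i‖) * ∑ i, ‖u i‖ * ‖w i‖ ^ 2 := by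
  have h1 : ‖∑ i, u i * w i‖ ≤ ∑ i, ‖u i‖ * ‖w i‖ := by
    refine (norm_sum_le _ _).trans (le_of_eq ?_)
    simp
  refine (pow_le_pow_left₀ (norm_nonneg _) h1 2).trans ?_
  refine Finset.sum_sq_le_sum_mul_sum_of_sq_le_mul _ (fun i _ => norm_nonneg _)
    (fun i _ => by positivity) (fun i _ => le_of_eq (by ring))

lemma rep_L2 {n a b : ℕ} {B : ℝ} {φ : ℂ → ℂ} (hφ : PolyRep a b B φ) (d w : Fin n → ℂ)
    (h x y e f : ℝ) (hxy : x ≤ y) (hef : e ≤ f)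
    (hk : ∀ k : ℕ, a ≤ k → k ≤ b → e ≤ x + k * h ∧ y + k * h ≤ f) :
    ∫ t in x..y, ‖∑ j, d j * Complex.exp (w j * t) * φ (Complex.exp (w j * h))‖ ^ 2
      ≤ B ^ 2 * ∫ t in e..f, ‖∑ j, d j * Complex.exp (w j * t)‖ ^ 2 := by
  have hB := hφ.nonneg
  obtain ⟨ι, _, u, k, h1, h2, h3⟩ := hφ
  set p : ℝ → ℂ := fun t => ∑ j, d j * Complex.exp (w j * t) with hp
  have hpc : Continuous p := by fun_prop
  have hform : ∀ t : ℝ, ∑ j, d j * Complex.exp (w j * t) * φ (Complex.exp (w j * h))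
      = ∑ i, u i * p (t + k i * h) := by
    intro t
    simp only [hp, h2, Finset.mul_sum]
    rw [Finset.sum_comm]
    refine Finset.sum_congr rfl fun i _ => Finset.sum_congr rfl fun j _ => ?_
    rw [← Complex.exp_nat_mul]
    push_cast
    rw [mul_add, Complex.exp_add]
    ring_nf
  simp only [hform]
  set K := ∫ t in e..f, ‖p t‖ ^ 2 with hK
  have hpoint : ∀ i, ∫ t in x..y, ‖p (t + k i * h)‖ ^ 2 ≤ K := by
    intro i
    have := hk (k i) (h1 i).1 (h1 i).2
    rw [intervalIntegral.integral_comp_add_right (fun t => ‖p t‖ ^ 2)]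
    refine intervalIntegral.integral_mono_interval this.1 (by linarith) this.2 ?_ ?_
    · exact Filter.Eventually.of_forall fun t => by positivity
    · exact (Continuous.intervalIntegrable (by fun_prop) _ _)
  have hK0 : 0 ≤ K := intervalIntegral.integral_nonneg hef fun t _ => by positivity
  calc ∫ t in x..y, ‖∑ i, u i * p (t + k i * h)‖ ^ 2
        ≤ ∫ t in x..y, (∑ i, ‖u i‖) * ∑ i, ‖u i‖ * ‖p (t + k i * h)‖ ^ 2 := by
          refine intervalIntegral.integral_mono_on hxy ?_ ?_ fun t _ => norm_sum_sq_le _ _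
          · exact Continuous.intervalIntegrable (by fun_prop) _ _
          · exact Continuous.intervalIntegrable (by fun_prop) _ _
      _ = (∑ i, ‖u i‖) * ∑ i, ‖u i‖ * ∫ t in x..y, ‖p (t + k i * h)‖ ^ 2 := by
          rw [intervalIntegral.integral_const_mul, intervalIntegral.integral_finsetSum]
          · simp only [intervalIntegral.integral_const_mul]
          · intro i _
            exact Continuous.intervalIntegrable (by fun_prop) _ _
      _ ≤ (∑ i, ‖u i‖) * ∑ i, ‖u i‖ * K := by
          gcongr with i
          exact hpoint i
      _ = (∑ i, ‖u i‖) ^ 2 * K := by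
          rw [← Finset.sum_mul]
          ring
      _ ≤ B ^ 2 * K := by
          gcongr

/-- Turán's lemma in `L²` form on one subinterval. -/
lemma turan_piece {N : ℕ} (d : Fin N → ℂ) (l : Fin N → ℝ) (M : ℕ) (h x y e f : ℝ)
    (hxy : x ≤ y) (hef : e ≤ f)
    (hk : ∀ k : ℕ, M + 1 ≤ k → k ≤ M + N → e ≤ x + k * h ∧ y + k * h ≤ f) :
    ∫ t in x..y, ‖∑ j, d j * Complex.exp (-(Complex.I * l j) * t)‖ ^ 2
      ≤ (5 ^ N * 2 ^ M) ^ 2 *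
        ∫ t in e..f, ‖∑ j, d j * Complex.exp (-(Complex.I * l j) * t)‖ ^ 2 := by
  obtain ⟨φ, h1, h2⟩ := turan_poly N (fun j => Complex.exp (-(Complex.I * l j) * h)) (by
    intro j
    rw [Complex.norm_exp]
    simp) M
  have := rep_L2 h1 d (fun j => -(Complex.I * l j)) h x y e f hxy hef hk
  simpa only [h2, mul_one] using this

lemma turan_L2 {N : ℕ} (hN : 1 ≤ N) (d : Fin N → ℂ) (l : Fin N → ℝ) (A δ : ℝ) (hδ : 0 ≤ δ) :
    ∫ t in A..(A + 8 * δ), ‖∑ j, d j * Complex.exp (-(Complex.I * l j) * t)‖ ^ 2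
      ≤ 8 * 25600 ^ N *
        ∫ t in (A + δ)..(A + 3 * δ), ‖∑ j, d j * Complex.exp (-(Complex.I * l j) * t)‖ ^ 2 := by
  set p : ℝ → ℝ := fun t => ‖∑ j, d j * Complex.exp (-(Complex.I * l j) * t)‖ ^ 2 with hp
  have hpc : Continuous p := by fun_prop
  have hN0 : (0:ℝ) < N := by exact_mod_cast hN
  set K := ∫ t in (A + δ)..(A + 3 * δ), p t with hK
  have hK0 : 0 ≤ K := intervalIntegral.integral_nonneg (by linarith) fun t _ => by
    simp only [hp]; positivity
  have hpow : ((5:ℝ) ^ N * 2 ^ (5 * N)) ^ 2 = 25600 ^ N := by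
    rw [pow_mul, ← mul_pow, ← pow_mul, mul_comm N 2, pow_mul]
    norm_num
  have hbig : (1:ℝ) ≤ 25600 ^ N := one_le_pow₀ (by norm_num)
  have hgen : ∀ i : ℕ, 3 ≤ i → i ≤ 7 →
      ∫ t in (A + (i:ℕ) * δ)..(A + ((i + 1 : ℕ)) * δ), p t ≤ 25600 ^ N * K := by
    intro i h3 h7
    have := turan_piece d l ((i - 2) * N) (-(δ / N)) (A + i * δ) (A + ((i + 1 : ℕ)) * δ)
      (A + δ) (A + 3 * δ) (by push_cast; nlinarith) (by linarith) (by
        intro k hk1 hk2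
        obtain ⟨r, rfl⟩ : ∃ r, i = r + 2 := ⟨i - 2, by omega⟩
        simp only [Nat.add_sub_cancel] at hk1 hk2
        have e1 : (r:ℝ) * N ≤ k := by
          have : r * N ≤ k := by omega
          exact_mod_cast this
        have e2 : (k:ℝ) ≤ r * N + N := by exact_mod_cast hk2
        have e3 : (k:ℝ) * -(δ / N) = -(k / N * δ) := by ring
        have e4 : (r:ℝ) ≤ k / N := by rw [le_div_iff₀ hN0]; exact e1
        have e5 : (k:ℝ) / N ≤ r + 1 := by rw [div_le_iff₀ hN0]; linarith
        rw [e3]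
        push_cast
        constructor <;> nlinarith)
    refine this.trans ?_
    refine mul_le_mul_of_nonneg_right ?_ hK0
    rw [← hpow]
    gcongr
    · norm_num
    · omega
  have hsmall : ∀ i : ℕ, 1 ≤ i → i ≤ 2 →
      ∫ t in (A + (i:ℕ) * δ)..(A + ((i + 1 : ℕ)) * δ), p t ≤ 25600 ^ N * K := by
    intro i h3 h7
    have e1 : (1:ℝ) ≤ i := by exact_mod_cast h3
    have e2 : (i:ℝ) ≤ 2 := by exact_mod_cast h7
    have : ∫ t in (A + (i:ℕ) * δ)..(A + ((i + 1 : ℕ)) * δ), p t ≤ K := by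
      refine intervalIntegral.integral_mono_interval ?_ ?_ ?_ ?_ ?_
      · nlinarith
      · push_cast; nlinarith
      · push_cast; nlinarith
      · exact Filter.Eventually.of_forall fun t => by simp only [hp]; positivity
      · exact hpc.intervalIntegrable _ _
    nlinarith
  have hzero : ∫ t in (A + (0:ℕ) * δ)..(A + ((0 + 1 : ℕ)) * δ), p t ≤ 25600 ^ N * K := by
    have := turan_piece d l N (δ / N) (A + (0:ℕ) * δ) (A + ((0 + 1 : ℕ)) * δ)
      (A + δ) (A + 3 * δ) (by push_cast; nlinarith) (by linarith) (by
        intro k hk1 hk2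
        have e1 : (N:ℝ) ≤ k := by
          have : N ≤ k := by omega
          exact_mod_cast this
        have e2 : (k:ℝ) ≤ N + N := by exact_mod_cast hk2
        have e3 : (k:ℝ) * (δ / N) = (k / N * δ) := by ring
        have e4 : (1:ℝ) ≤ k / N := by rw [le_div_iff₀ hN0]; linarith
        have e5 : (k:ℝ) / N ≤ 2 := by rw [div_le_iff₀ hN0]; linarith
        rw [e3]
        push_cast
        constructor <;> nlinarith)
    refine this.trans ?_
    refine mul_le_mul_of_nonneg_right ?_ hK0
    rw [← hpow]
    gcongr
    · norm_num
    · omega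
  have hall : ∀ i ∈ Finset.range 8,
      ∫ t in (A + (i:ℕ) * δ)..(A + ((i + 1 : ℕ)) * δ), p t ≤ 25600 ^ N * K := by
    intro i hi
    rw [Finset.mem_range] at hi
    rcases Nat.eq_zero_or_pos i with rfl | h0
    · exact hzero
    · rcases Nat.lt_or_ge i 3 with h | h
      · exact hsmall i h0 (by omega)
      · exact hgen i h (by omega)
  have hsum := intervalIntegral.sum_integral_adjacent_intervals (f := p) (μ := volume)
    (a := fun i : ℕ => A + i * δ) (n := 8) (fun k _ => hpc.intervalIntegrable _ _)
  have h8 := Finset.sum_le_sum hall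
  rw [hsum] at h8
  simp only [Finset.sum_const, Finset.card_range, nsmul_eq_mul] at h8
  push_cast at h8
  rw [zero_mul, add_zero] at h8
  linarith

lemma exp_sub_lower {a b S r : ℝ} (ha : 0 ≤ a) (hb : 0 ≤ b) (haS : a ≤ S) (hbS : b ≤ S)
    (hr : r ≤ |a - b|) : r * Real.exp (-S) ≤ |Real.exp (-a) - Real.exp (-b)| := by
  wlog hab : a ≤ b generalizing a b
  · rw [abs_sub_comm] at hr ⊢
    exact this hb ha hbS haS hr (le_of_not_ge hab)
  · rw [abs_of_nonneg (sub_nonneg.2 (Real.exp_le_exp.2 (by linarith)))]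
    rw [abs_sub_comm, abs_of_nonneg (by linarith)] at hr
    have h1 : Real.exp (-a) = Real.exp (-b) * Real.exp (b - a) := by
      rw [← Real.exp_add]; ring_nf
    have h2 := Real.add_one_le_exp (b - a)
    have h3 : Real.exp (-S) ≤ Real.exp (-b) := Real.exp_le_exp.2 (by linarith)
    have h4 := Real.exp_pos (-S)
    rw [h1]
    nlinarith [Real.exp_pos (-b), mul_le_mul_of_nonneg_right hr h4.le,
      mul_le_mul_of_nonneg_left h3 (by linarith : 0 ≤ b - a)]

lemma exp_lower {m : ℕ} (hm : 1 ≤ m) (F : Fin m → ℂ) (μ : Fin m → ℝ) (S δ : ℝ) (hδ : 0 ≤ δ)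
    (hμ0 : ∀ j, 0 ≤ μ j) (hμS : ∀ j, μ j ≤ S)
    (hsep : ∀ j k, j ≠ k → δ ≤ |μ j - μ k|) :
    (1 / m) * Real.exp (-S) ^ 2 * ((δ / m * Real.exp (-S)) ^ (m - 1)) ^ 2 * ∑ j, ‖F j‖ ^ 2
      ≤ m * (2 ^ (m - 1)) ^ 2 * ∫ t in (0:ℝ)..1, ‖∑ j, F j * Complex.exp (-(μ j) * t)‖ ^ 2 := by
  have hm0 : (0:ℝ) < m := by exact_mod_cast hm
  have hm1 : (1:ℝ) ≤ m := by exact_mod_cast hm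
  set J := ∫ t in (0:ℝ)..1, ‖∑ j, F j * Complex.exp (-(μ j) * t)‖ ^ 2 with hJ
  have key : ∀ j₀, (1 / m) * Real.exp (-S) ^ 2 * ((δ / m * Real.exp (-S)) ^ (m - 1)) ^ 2 *
      ‖F j₀‖ ^ 2 ≤ (2 ^ (m - 1)) ^ 2 * J := by
    intro j₀
    set v : Fin m → ℂ := fun j => Complex.exp (-(μ j) * ((1 / m : ℝ) : ℂ)) with hv
    have hvr : ∀ j, v j = ((Real.exp (-(μ j / m)) : ℝ) : ℂ) := by
      intro j
      simp only [hv]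
      push_cast
      congr 1
      ring
    have hv1 : ∀ j, ‖v j‖ ≤ 1 := by
      intro j
      rw [hvr, Complex.norm_real, Real.norm_eq_abs, abs_of_pos (Real.exp_pos _)]
      exact Real.exp_le_one_iff.2 (by have := hμ0 j; have : 0 ≤ μ j / m := by positivity
                                      linarith)
    have hrep := PolyRep.prod (Finset.univ.erase j₀) v hv1
    have hcard : (Finset.univ.erase j₀).card = m - 1 := by
      rw [Finset.card_erase_of_mem (Finset.mem_univ _)]; simp
    rw [hcard] at hrep
    set φ : ℂ → ℂ := fun z => ∏ i ∈ Finset.univ.erase j₀, (z - v i) with hφ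
    have hL := rep_L2 hrep F (fun j => -(μ j : ℂ)) (1 / m) 0 (1 / m) 0 1 (by positivity)
      zero_le_one (by
        intro k _ hk
        have e1 : (k:ℝ) + 1 ≤ m := by
          have : k + 1 ≤ m := by omega
          exact_mod_cast this
        constructor
        · positivity
        · have : (1:ℝ) / m + k * (1 / m) = (k + 1) / m := by ring
          rw [this, div_le_one hm0]
          exact e1)
    have hzero : ∀ j, j ≠ j₀ → φ (v j) = 0 := by
      intro j hj
      exact Finset.prod_eq_zero (Finset.mem_erase.2 ⟨hj, Finset.mem_univ j⟩) (sub_self _)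
    have hform : ∀ t : ℝ, ∑ j, F j * Complex.exp (-(μ j : ℂ) * t) *
        φ (Complex.exp (-(μ j : ℂ) * ((1 / m : ℝ) : ℂ)))
        = F j₀ * Complex.exp (-(μ j₀ : ℂ) * t) * φ (v j₀) := by
      intro t
      refine Finset.sum_eq_single j₀ ?_ ?_
      · intro j _ hj
        have := hzero j hj
        simp only [hv] at this
        rw [this, mul_zero]
      · simp
    simp only [hform] at hL
    refine le_trans ?_ hL
    have hφl : (δ / m * Real.exp (-S)) ^ (m - 1) ≤ ‖φ (v j₀)‖ := by
      simp only [hφ, norm_prod]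
      rw [← hcard, ← Finset.prod_const]
      refine Finset.prod_le_prod (fun i _ => by positivity) ?_
      intro i hi
      have hne := (Finset.mem_erase.1 hi).1
      rw [hvr, hvr, ← Complex.ofReal_sub, Complex.norm_real, Real.norm_eq_abs]
      have hle : ∀ j, μ j / m ≤ S := fun j => by
        refine le_trans ?_ (hμS j)
        exact div_le_self (hμ0 j) hm1
      refine exp_sub_lower (div_nonneg (hμ0 _) hm0.le) (div_nonneg (hμ0 _) hm0.le) (hle _)
        (hle _) ?_
      rw [← sub_div, abs_div, abs_of_pos hm0]
      exact div_le_div_of_nonneg_right (hsep _ _ hne.symm) hm0.le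
    have hconst : ∫ _t in (0:ℝ)..(1 / m), Real.exp (-S) ^ 2 *
        ((δ / m * Real.exp (-S)) ^ (m - 1)) ^ 2 * ‖F j₀‖ ^ 2
        = (1 / m) * Real.exp (-S) ^ 2 * ((δ / m * Real.exp (-S)) ^ (m - 1)) ^ 2 *
      ‖F j₀‖ ^ 2 := by
      rw [intervalIntegral.integral_const, smul_eq_mul]
      ring
    rw [← hconst]
    refine intervalIntegral.integral_mono_on (by positivity) ?_ ?_ ?_
    · exact Continuous.intervalIntegrable (by fun_prop) _ _
    · exact Continuous.intervalIntegrable (by fun_prop) _ _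
    · intro t ht
      have ht1 : t ≤ 1 := ht.2.trans (by rw [div_le_one hm0]; exact hm1)
      have hexp : Real.exp (-S) ≤ ‖Complex.exp (-(μ j₀ : ℂ) * t)‖ := by
        rw [Complex.norm_exp]
        refine Real.exp_le_exp.2 ?_
        simp
        nlinarith [hμ0 j₀, hμS j₀, ht.1]
      have hn : ‖F j₀ * Complex.exp (-(μ j₀ : ℂ) * t) * φ (v j₀)‖ ^ 2 =
          ‖Complex.exp (-(μ j₀ : ℂ) * t)‖ ^ 2 * ‖φ (v j₀)‖ ^ 2 * ‖F j₀‖ ^ 2 := by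
        rw [norm_mul, norm_mul]
        ring
      rw [hn]
      gcongr
  rw [Finset.mul_sum]
  refine (Finset.sum_le_sum fun j _ => key j).trans (le_of_eq ?_)
  simp
  ring

lemma split_integral_s11 {E : Type*} [NormedAddCommGroup E] [NormedSpace ℝ E] (q : ℝ → E)
    (hq : Continuous q) (a T : ℝ) (m : ℕ) :
    ∫ x in a..(a + m * T), q x = ∑ j : Fin m, ∫ x in a..(a + T), q (x + j * T) := by
  have hsum := intervalIntegral.sum_integral_adjacent_intervals (f := q) (μ := volume)
    (a := fun i : ℕ => a + i * T) (n := m) (fun k _ => hq.intervalIntegrable _ _)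
  simp only [Nat.cast_zero, zero_mul, add_zero] at hsum
  rw [← hsum, Finset.sum_range]
  refine Finset.sum_congr rfl fun j _ => ?_
  rw [intervalIntegral.integral_comp_add_right q]
  congr 1
  push_cast
  ring

lemma parseval_sample (c : ℝ) (hc : 0 < c) (m : ℕ) (hm : 1 ≤ m) (Q : ℝ → ℂ)
    (hQ : Continuous Q) :
    ∑' k : ℤ, ‖((1 / (2 * Real.pi) : ℝ) : ℂ) * ∫ ξ in (-c)..c,
        Q ξ * Complex.exp (Complex.I * (((m:ℝ) * Real.pi / c * (k:ℝ) : ℝ) : ℂ) * ξ)‖ ^ 2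
      = c / (2 * Real.pi ^ 2 * m) *
        ∫ ξ in (-c)..(-c + 2 * c / m), ‖∑ j : Fin m, Q (ξ + j * (2 * c / m))‖ ^ 2 := by
  have hm0 : (0:ℝ) < m := by exact_mod_cast hm
  set T := 2 * c / m with hT
  have hT0 : 0 < T := by positivity
  have hmT : m * T = 2 * c := by rw [hT]; field_simp
  have hab : -c < -c + T := by linarith
  set H : ℝ → ℂ := fun ξ => ∑ j : Fin m, Q (ξ + j * T) with hH
  have hHc : Continuous H := by fun_prop
  have hL2 : MemLp H 2 (volume.restrict (Set.Ioc (-c) (-c + T))) := by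
    rw [memLp_two_iff_integrable_sq_norm hHc.aestronglyMeasurable]
    exact (Continuous.integrableOn_Ioc (by fun_prop))
  have hP := tsum_sq_fourierCoeffOn hab hL2
  have hsamp : ∀ k : ℤ, ∫ ξ in (-c)..c,
        Q ξ * Complex.exp (Complex.I * (((m:ℝ) * Real.pi / c * (k:ℝ) : ℝ) : ℂ) * ξ)
        = T * fourierCoeffOn hab H (-k) := by
    intro k
    rw [fourierCoeffOn_eq_integral]
    have e1 : (c:ℝ) = -c + m * T := by linarith
    have hcc : (c:ℂ) ≠ 0 := by exact_mod_cast hc.ne'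
    have hmc : (m:ℂ) ≠ 0 := by exact_mod_cast hm0.ne'
    have hTc : (T:ℂ) ≠ 0 := by exact_mod_cast hT0.ne'
    have hTc' : (T:ℂ) = 2 * c / m := by rw [hT]; push_cast; ring
    have hsp := split_integral_s11 (fun ξ : ℝ => Q ξ *
      Complex.exp (Complex.I * (((m:ℝ) * Real.pi / c * (k:ℝ) : ℝ) : ℂ) * ξ)) (by fun_prop)
      (-c) T m
    rw [← e1] at hsp
    rw [hsp, ← intervalIntegral.integral_finsetSum]
    · rw [add_sub_cancel_left, Complex.real_smul]
      push_cast
      rw [← mul_assoc (T:ℂ), mul_one_div_cancel hTc, one_mul]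
      refine intervalIntegral.integral_congr fun x _ => ?_
      simp only [hH, smul_eq_mul, Finset.mul_sum]
      refine Finset.sum_congr rfl fun j _ => ?_
      rw [mul_comm]
      congr 1
      rw [fourier_coe_apply, neg_neg, Complex.exp_eq_exp_iff_exists_int]
      refine ⟨k * j, ?_⟩
      push_cast
      rw [hTc']
      field_simp
    · intro j _
      exact Continuous.intervalIntegrable (by fun_prop) _ _
  simp only [hsamp]
  have h2 : ∀ k : ℤ, ‖((1 / (2 * Real.pi) : ℝ) : ℂ) * (T * fourierCoeffOn hab H (-k))‖ ^ 2
      = (T / (2 * Real.pi)) ^ 2 * ‖fourierCoeffOn hab H (-k)‖ ^ 2 := by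
    intro k
    rw [norm_mul, norm_mul, Complex.norm_real, Complex.norm_real, Real.norm_eq_abs,
      Real.norm_eq_abs, abs_of_pos hT0, abs_of_pos (by positivity)]
    ring
  simp only [h2]
  rw [tsum_mul_left]
  have h3 : ∑' k : ℤ, ‖fourierCoeffOn hab H (-k)‖ ^ 2 = ∑' k : ℤ, ‖fourierCoeffOn hab H k‖ ^ 2 :=
    (Equiv.neg ℤ).tsum_eq (fun k => ‖fourierCoeffOn hab H k‖ ^ 2)
  rw [h3, hP, add_sub_cancel_left, smul_eq_mul, ← mul_assoc]
  congr 1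
  rw [hT]
  field_simp

lemma numeric (c : ℝ) (hc : 0 < c) (σ : ℝ) (hσ : σ ≠ 0) (m : ℕ) (hm : 2 ≤ m) (N : ℕ) :
    (c * (1 / (16 * Real.pi ^ 2)) / ((σ * c) ^ 2 + (m:ℝ))) *
      Real.exp (-(Real.log 25600 * (N:ℝ)) -
        (m:ℝ) ^ 2 * (-(4 * Real.log |σ|) +
          (2 + 2 * c ^ 2 + Real.exp (8 + 2 * |Real.log c|)) * σ ^ 2 + Real.log (m:ℝ)))
      * (8 * 25600 ^ N * (m * (2 ^ (m - 1)) ^ 2))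
    ≤ c / (2 * Real.pi ^ 2 * m) * ((1 / m) * Real.exp (-(σ * c) ^ 2) ^ 2 *
        (((σ * c) ^ 2 / m ^ 2 / m * Real.exp (-(σ * c) ^ 2)) ^ (m - 1)) ^ 2) := by
  have hm0 : (0:ℝ) < m := by positivity
  have hm2 : (2:ℝ) ≤ m := by exact_mod_cast hm
  set S := (σ * c) ^ 2 with hS
  have hS0 : 0 < S := by positivity
  set C := 8 + 2 * |Real.log c| with hC
  set X := -(4 * Real.log |σ|) + (2 + 2 * c ^ 2 + Real.exp C) * σ ^ 2 + Real.log (m:ℝ) with hX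
  have hσ0 : 0 < |σ| := abs_pos.2 hσ
  have hSc : S = |σ| ^ 2 * c ^ 2 := by rw [hS, sq_abs]; ring
  have hlogS : Real.log S = 2 * Real.log |σ| + 2 * Real.log c := by
    rw [hSc, Real.log_mul (by positivity) (by positivity), Real.log_pow, Real.log_pow]
    push_cast; ring
  set L := Real.log |σ| with hL
  set lm := Real.log (m:ℝ) with hlm
  have hlm0 : 0 ≤ lm := Real.log_nonneg (by linarith)
  have hlm1 : lm ≤ m - 1 := Real.log_le_sub_one_of_pos hm0
  have hLs : L ≤ σ ^ 2 := by
    have h1 : L ≤ |σ| - 1 := Real.log_le_sub_one_of_pos hσ0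
    nlinarith [sq_abs σ, sq_nonneg (|σ| - 1)]
  have hA : C ≤ -(2 * L) + Real.exp C * σ ^ 2 := by
    have hy : 0 < Real.exp C * |σ| ^ 2 := by positivity
    have h1 := Real.log_le_sub_one_of_pos hy
    rw [Real.log_mul (by positivity) (by positivity), Real.log_exp, Real.log_pow] at h1
    push_cast at h1
    rw [sq_abs] at h1
    linarith
  have hmain : -(m ^ 2 * X) + m * 2 ≤
      -(2 * lm) - 2 * S + 2 * m * (Real.log S - S - 3 * lm) := by
    have hsm : S = σ ^ 2 * c ^ 2 := by rw [hS]; ring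
    have hmm : (2:ℝ) * m ≤ m ^ 2 := by nlinarith
    have t1 : 2 * lm ≤ m ^ 2 := by nlinarith
    have t2 : 6 * m * lm ≤ 6 * m ^ 2 := by nlinarith
    have t3 : 2 * S + 2 * m * S ≤ 2 * m ^ 2 * S := by nlinarith
    have t4 : -(4 * m * Real.log c) ≤ 2 * m ^ 2 * |Real.log c| := by
      have := neg_abs_le (Real.log c)
      nlinarith [abs_nonneg (Real.log c)]
    have t5 : -(4 * m * L) ≤ -(2 * m ^ 2 * L) + 2 * m ^ 2 * σ ^ 2 := by
      rcases le_total 0 L with h | h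
      · nlinarith [mul_nonneg hm0.le h, mul_le_mul_of_nonneg_left hLs (by positivity : (0:ℝ) ≤ m ^ 2)]
      · nlinarith [mul_nonneg (by positivity : (0:ℝ) ≤ m ^ 2) (sq_nonneg σ)]
    have t6 := mul_le_mul_of_nonneg_left hA (by positivity : (0:ℝ) ≤ m ^ 2)
    have t7 : 0 ≤ m ^ 2 * lm := by positivity
    rw [hlogS]
    rw [hX]
    rw [hC] at t6 ⊢
    rw [hsm] at t3 ⊢
    nlinarith
  set r := S / m ^ 2 / m * Real.exp (-S) with hr
  have hr0 : 0 < r := by positivity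
  have hrexp : r = Real.exp (Real.log S - S - 3 * lm) := by
    rw [Real.exp_sub, Real.exp_sub, Real.exp_log hS0, hr, Real.exp_neg]
    have : Real.exp (3 * lm) = m ^ 3 := by
      rw [mul_comm, Real.exp_mul, hlm, Real.exp_log hm0]; norm_cast
    rw [this]
    field_simp
  have hr1 : r ≤ 1 := by
    rw [hrexp]
    refine Real.exp_le_one_iff.2 ?_
    have := Real.log_le_sub_one_of_pos hS0
    linarith
  have hpow : r ^ m ≤ r ^ (m - 1) := pow_le_pow_of_le_one hr0.le hr1 (by omega)
  have h4 : ((2:ℝ) ^ (m - 1)) ^ 2 ≤ Real.exp (m * 2) := by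
    have h2 : (2:ℝ) ≤ Real.exp 1 := by
      have := Real.add_one_le_exp (1:ℝ); linarith
    calc ((2:ℝ) ^ (m - 1)) ^ 2 ≤ (2 ^ m) ^ 2 := by
          gcongr
          · norm_num
          · omega
      _ ≤ (Real.exp 1 ^ m) ^ 2 := by gcongr
      _ = Real.exp (m * 2) := by
          rw [← pow_mul, ← Real.exp_nat_mul]; push_cast; ring_nf
  have hexp : Real.exp (-(m ^ 2 * X)) * Real.exp (m * 2) ≤
      (1 / m ^ 2) * Real.exp (-S) ^ 2 * (r ^ m) ^ 2 := by
    have e1 : (1 / (m:ℝ) ^ 2) = Real.exp (-(2 * lm)) := by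
      rw [Real.exp_neg, mul_comm, Real.exp_mul, hlm, Real.exp_log hm0]; norm_cast; simp
    have e2 : (r ^ m) ^ 2 = Real.exp (2 * m * (Real.log S - S - 3 * lm)) := by
      rw [hrexp, ← pow_mul, ← Real.exp_nat_mul]; push_cast; ring_nf
    have e3 : Real.exp (-S) ^ 2 = Real.exp (-(2 * S)) := by
      rw [← Real.exp_nat_mul]; push_cast; ring_nf
    rw [e1, e2, e3, ← Real.exp_add, ← Real.exp_add, ← Real.exp_add]
    exact Real.exp_le_exp.2 (by linarith)
  have hN : Real.exp (-(Real.log 25600 * (N:ℝ)) - m ^ 2 * X) * 25600 ^ N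
      = Real.exp (-(m ^ 2 * X)) := by
    have : (25600:ℝ) ^ N = Real.exp (Real.log 25600 * N) := by
      rw [Real.exp_mul, Real.exp_log (by norm_num)]; norm_cast
    rw [this, ← Real.exp_add]
    congr 1
    ring
  have hpi := Real.pi_pos
  calc _ = (c / (2 * Real.pi ^ 2)) * (m / (S + m)) *
          ((Real.exp (-(Real.log 25600 * (N:ℝ)) - m ^ 2 * X) * 25600 ^ N) * (2 ^ (m - 1)) ^ 2) := by
        field_simp
        norm_num
    _ ≤ (c / (2 * Real.pi ^ 2)) * 1 * (Real.exp (-(m ^ 2 * X)) * Real.exp (m * 2)) := by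
        rw [hN]
        gcongr
        rw [div_le_one (by positivity)]
        linarith
    _ ≤ (c / (2 * Real.pi ^ 2)) * 1 * ((1 / m ^ 2) * Real.exp (-S) ^ 2 * (r ^ (m - 1)) ^ 2) := by
        have : (1 / (m:ℝ) ^ 2) * Real.exp (-S) ^ 2 * (r ^ m) ^ 2 ≤
          (1 / m ^ 2) * Real.exp (-S) ^ 2 * (r ^ (m - 1)) ^ 2 := by gcongr
        have h7 := hexp.trans this
        gcongr
    _ = _ := by
        field_simp

set_option maxHeartbeats 800000 in
lemma core_bounds (c : ℝ) (hc : 0 < c) (σ : ℝ) (m : ℕ) (hm : 1 ≤ m) (N : ℕ)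
    (hN : 1 ≤ N) (d : Fin N → ℂ) (l : Fin N → ℝ) (p : ℝ → ℂ)
    (hp : p = fun x : ℝ => ∑ j, d j * Complex.exp (-(Complex.I * l j) * x))
    (G : ℝ → ℝ) (hG : G = fun t : ℝ => c / (2 * Real.pi ^ 2 * m) *
        ∫ ξ in (-c)..(-c + 2 * c / m), ‖∑ j : Fin m, p (ξ + j * (2 * c / m)) *
          Complex.exp (-((σ ^ 2 * (ξ + j * (2 * c / m)) ^ 2 : ℝ) : ℂ) * t)‖ ^ 2) :
    (c / (2 * Real.pi ^ 2 * m) * ((1 / m) * Real.exp (-(σ * c) ^ 2) ^ 2 *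
        (((σ * c) ^ 2 / m ^ 2 / m * Real.exp (-(σ * c) ^ 2)) ^ (m - 1)) ^ 2) *
      ∫ x in (-c)..c, ‖p x‖ ^ 2)
      ≤ (8 * 25600 ^ N * (m * (2 ^ (m - 1)) ^ 2)) * (∫ t in (0:ℝ)..1, G t) ∧
    ∫ t in (0:ℝ)..1, G t ≤ c / (2 * Real.pi ^ 2) * ∫ x in (-c)..c, ‖p x‖ ^ 2 := by
  have hm0 : (0:ℝ) < m := by exact_mod_cast hm
  have hpi := Real.pi_pos
  set T := 2 * c / m with hT
  have hT0 : 0 < T := by positivity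
  have hmT : m * T = 2 * c := by rw [hT]; field_simp
  have e1 : (c:ℝ) = -c + m * T := by linarith
  have hpc : Continuous p := by rw [hp]; fun_prop
  obtain ⟨q, hq⟩ : ∃ q : ℝ → ℝ → ℝ, ∀ t ξ, q t ξ = ‖∑ j : Fin m, p (ξ + j * T) *
          Complex.exp (-((σ ^ 2 * (ξ + j * T) ^ 2 : ℝ) : ℂ) * t)‖ ^ 2 := ⟨_, fun _ _ => rfl⟩
  have hqc : Continuous (Function.uncurry q) := by
    have : Function.uncurry q = fun x : ℝ × ℝ => ‖∑ j : Fin m, p (x.2 + j * T) *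
          Complex.exp (-((σ ^ 2 * (x.2 + j * T) ^ 2 : ℝ) : ℂ) * x.1)‖ ^ 2 := by
      funext x
      exact hq x.1 x.2
    rw [this]
    fun_prop
  have hqt : ∀ t, Continuous (q t) := fun t => hqc.uncurry_left t
  simp only [← hq] at hG
  have hP2 : ∫ x in (-c)..c, ‖p x‖ ^ 2 = ∑ j : Fin m, ∫ x in (-c)..(-c + T), ‖p (x + j * T)‖ ^ 2 := by
    have := split_integral_s11 (fun x => ‖p x‖ ^ 2) (by fun_prop) (-c) T m
    rw [← e1] at this
    exact this
  set P2 := ∫ x in (-c)..c, ‖p x‖ ^ 2 with hP2d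
  have hGc : Continuous G := by
    rw [hG]
    refine continuous_const.mul ?_
    exact intervalIntegral.continuous_parametric_intervalIntegral_of_continuous' hqc _ _
  constructor
  · have hswap : ∫ t in (0:ℝ)..1, G t = c / (2 * Real.pi ^ 2 * m) *
        ∫ ξ in (-c)..(-c + T), ∫ t in (0:ℝ)..1, q t ξ := by
      rw [hG, intervalIntegral.integral_const_mul]
      congr 1
      refine intervalIntegral_intervalIntegral_swap ?_
      refine IntegrableOn.mono_set (t := Set.uIcc 0 1 ×ˢ Set.uIcc (-c) (-c + T)) ?_ ?_
      · exact hqc.continuousOn.integrableOn_compact (isCompact_uIcc.prod isCompact_uIcc)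
      · exact Set.prod_mono Set.uIoc_subset_uIcc Set.uIoc_subset_uIcc
    obtain ⟨inner, hinner⟩ : ∃ inner : ℝ → ℝ, inner = fun ξ => ∫ t in (0:ℝ)..1, q t ξ :=
      ⟨_, rfl⟩
    have hinner' : ∀ ξ, ∫ t in (0:ℝ)..1, q t ξ = inner ξ := fun ξ => by rw [hinner]
    simp only [hinner'] at hswap
    have hqc' : Continuous (Function.uncurry fun ξ t => q t ξ) :=
      hqc.comp continuous_swap
    have hinc : Continuous inner := by
      rw [hinner]
      exact intervalIntegral.continuous_parametric_intervalIntegral_of_continuous' hqc' _ _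
    have hin0 : ∀ ξ, 0 ≤ inner ξ := fun ξ => by
      rw [← hinner']
      exact intervalIntegral.integral_nonneg zero_le_one fun t _ => by rw [hq]; positivity
    set c0 : ℝ := (1 / m) * Real.exp (-(σ * c) ^ 2) ^ 2 *
        (((σ * c) ^ 2 / m ^ 2 / m * Real.exp (-(σ * c) ^ 2)) ^ (m - 1)) ^ 2 with hc0
    have hc00 : 0 ≤ c0 := by positivity
    have hpt : ∀ ξ ∈ Set.Icc (-c + T / 8) (-c + 3 * (T / 8)),
        c0 * ∑ j : Fin m, ‖p (ξ + j * T)‖ ^ 2 ≤ (m * (2 ^ (m - 1)) ^ 2) * inner ξ := by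
      intro ξ hξ
      rw [← hinner']
      simp only [hq]
      refine exp_lower hm (fun j : Fin m => p (ξ + j * T))
        (fun j : Fin m => σ ^ 2 * (ξ + j * T) ^ 2) ((σ * c) ^ 2) ((σ * c) ^ 2 / m ^ 2)
        (by positivity) (fun j => by positivity) ?_ ?_
      · intro j
        have hj : (j:ℝ) + 1 ≤ m := by exact_mod_cast j.2
        have hj0 : (0:ℝ) ≤ j := by positivity
        have h1 : -c ≤ ξ + j * T := by nlinarith [hξ.1]
        have h2 : ξ + j * T ≤ c := by nlinarith [hξ.2]
        have h3 : (ξ + j * T) ^ 2 ≤ c ^ 2 := sq_le_sq' h1 h2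
        rw [mul_pow]
        exact mul_le_mul_of_nonneg_left h3 (sq_nonneg σ)
      · intro j k hjk
        have hTm : (σ * c) ^ 2 / m ^ 2 = σ ^ 2 * (T * (T * (1 / 4))) := by
          rw [hT]; field_simp; norm_num
        have hdiff : σ ^ 2 * (ξ + j * T) ^ 2 - σ ^ 2 * (ξ + k * T) ^ 2
            = σ ^ 2 * ((((j:ℤ) - (k:ℤ) : ℤ) : ℝ) * T * (2 * ξ + (j + k) * T)) := by
          push_cast; ring
        rw [hTm, hdiff, abs_mul, abs_mul, abs_mul, abs_of_nonneg (sq_nonneg σ), abs_of_pos hT0]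
        have h1 : (1:ℝ) ≤ |(((j:ℤ) - (k:ℤ) : ℤ) : ℝ)| := by
          have hne : ((j:ℤ) - (k:ℤ)) ≠ 0 := by
            intro h
            apply hjk
            ext
            omega
          have := Int.one_le_abs hne
          exact_mod_cast this
        have h2 : T * (1 / 4) ≤ |2 * ξ + (j + k) * T| := by
          have hs : 2 * ξ + ((j:ℝ) + k) * T
              = 2 * (ξ + c) + (((j:ℤ) + (k:ℤ) - (m:ℤ) : ℤ) : ℝ) * T := by
            push_cast
            linear_combination hmT
          rw [hs]
          rcases le_or_gt 0 ((j:ℤ) + (k:ℤ) - (m:ℤ)) with h | h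
          · have h' : (0:ℝ) ≤ (((j:ℤ) + (k:ℤ) - (m:ℤ) : ℤ) : ℝ) := by exact_mod_cast h
            refine le_trans ?_ (le_abs_self _)
            nlinarith [hξ.1]
          · have h' : (((j:ℤ) + (k:ℤ) - (m:ℤ) : ℤ) : ℝ) ≤ -1 := by
              have : (j:ℤ) + (k:ℤ) - (m:ℤ) ≤ -1 := by omega
              exact_mod_cast this
            refine le_trans ?_ (neg_le_abs _)
            nlinarith [hξ.2]
        refine mul_le_mul_of_nonneg_left ?_ (sq_nonneg σ)
        calc T * (T * (1 / 4)) = 1 * T * (T * (1 / 4)) := by ring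
          _ ≤ _ := by gcongr
    have hint : c0 * ∑ j : Fin m, ∫ ξ in (-c + T / 8)..(-c + 3 * (T / 8)), ‖p (ξ + j * T)‖ ^ 2
        ≤ (m * (2 ^ (m - 1)) ^ 2) * ∫ ξ in (-c)..(-c + T), inner ξ := by
      rw [← intervalIntegral.integral_finsetSum (fun j _ =>
        Continuous.intervalIntegrable (by fun_prop) _ _), ← intervalIntegral.integral_const_mul]
      calc _ ≤ ∫ ξ in (-c + T / 8)..(-c + 3 * (T / 8)), (m * (2 ^ (m - 1)) ^ 2) * inner ξ := by
            refine intervalIntegral.integral_mono_on (by linarith) ?_ ?_ hpt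
            · exact Continuous.intervalIntegrable (by fun_prop) _ _
            · exact Continuous.intervalIntegrable (by fun_prop) _ _
        _ ≤ _ := by
            rw [intervalIntegral.integral_const_mul]
            refine mul_le_mul_of_nonneg_left ?_ (by positivity)
            refine intervalIntegral.integral_mono_interval (by linarith) (by linarith)
              (by linarith) ?_ (hinc.intervalIntegrable _ _)
            exact Filter.Eventually.of_forall fun t => hin0 t
    have htur : P2 ≤ 8 * 25600 ^ N *
        ∑ j : Fin m, ∫ ξ in (-c + T / 8)..(-c + 3 * (T / 8)), ‖p (ξ + j * T)‖ ^ 2 := by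
      rw [hP2, Finset.mul_sum]
      refine Finset.sum_le_sum fun j _ => ?_
      have := turan_L2 hN d l (-c + j * T) (T / 8) (by positivity)
      rw [intervalIntegral.integral_comp_add_right (fun x => ‖p x‖ ^ 2),
        intervalIntegral.integral_comp_add_right (fun x => ‖p x‖ ^ 2), hp]
      have ea : -c + T + j * T = -c + j * T + 8 * (T / 8) := by ring
      have eb : -c + T / 8 + j * T = -c + j * T + T / 8 := by ring
      have ec : -c + 3 * (T / 8) + j * T = -c + j * T + 3 * (T / 8) := by ring
      rw [ea, eb, ec]
      exact this
    rw [hswap]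
    have hcm : 0 ≤ c / (2 * Real.pi ^ 2 * m) := by positivity
    calc c / (2 * Real.pi ^ 2 * m) * c0 * P2
        ≤ c / (2 * Real.pi ^ 2 * m) * c0 * (8 * 25600 ^ N *
        ∑ j : Fin m, ∫ ξ in (-c + T / 8)..(-c + 3 * (T / 8)), ‖p (ξ + j * T)‖ ^ 2) := by
          gcongr
      _ = c / (2 * Real.pi ^ 2 * m) * (8 * 25600 ^ N) * (c0 *
        ∑ j : Fin m, ∫ ξ in (-c + T / 8)..(-c + 3 * (T / 8)), ‖p (ξ + j * T)‖ ^ 2) := by ring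
      _ ≤ c / (2 * Real.pi ^ 2 * m) * (8 * 25600 ^ N) *
          ((m * (2 ^ (m - 1)) ^ 2) * ∫ ξ in (-c)..(-c + T), inner ξ) := by
          exact mul_le_mul_of_nonneg_left hint (by positivity)
      _ = _ := by ring
  · have hle : ∀ t ∈ Set.Icc (0:ℝ) 1, G t ≤ c / (2 * Real.pi ^ 2) * P2 := by
      intro t ht
      have hGt : G t = c / (2 * Real.pi ^ 2 * m) * ∫ ξ in (-c)..(-c + T), q t ξ := by rw [hG]
      have hb : ∫ ξ in (-c)..(-c + T), q t ξ ≤ m * P2 := by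
        rw [hP2, ← intervalIntegral.integral_finsetSum (fun j _ =>
          Continuous.intervalIntegrable (by fun_prop) _ _), ← intervalIntegral.integral_const_mul]
        refine intervalIntegral.integral_mono_on (by linarith) ((hqt t).intervalIntegrable _ _)
          (Continuous.intervalIntegrable (by fun_prop) _ _) ?_
        intro ξ _
        have h1 := norm_sum_sq_le (fun _ : Fin m => (1:ℂ)) (fun j : Fin m => p (ξ + j * T) *
          Complex.exp (-((σ ^ 2 * (ξ + j * T) ^ 2 : ℝ) : ℂ) * t))
        simp only [one_mul, norm_one, Finset.sum_const, Finset.card_univ, Fintype.card_fin,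
          nsmul_eq_mul, mul_one] at h1
        rw [hq]
        refine h1.trans ?_
        refine mul_le_mul_of_nonneg_left ?_ hm0.le
        refine Finset.sum_le_sum fun j _ => ?_
        refine pow_le_pow_left₀ (norm_nonneg _) ?_ 2
        rw [norm_mul]
        refine mul_le_of_le_one_right (norm_nonneg _) ?_
        rw [Complex.norm_exp]
        refine Real.exp_le_one_iff.2 ?_
        have : (-((σ ^ 2 * (ξ + j * T) ^ 2 : ℝ) : ℂ) * t)
            = ((-(σ ^ 2 * (ξ + j * T) ^ 2 * t) : ℝ) : ℂ) := by push_cast; ring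
        rw [this, Complex.ofReal_re]
        have := ht.1
        have : 0 ≤ σ ^ 2 * (ξ + j * T) ^ 2 * t := by positivity
        linarith
      rw [hGt]
      calc _ ≤ c / (2 * Real.pi ^ 2 * m) * (m * P2) :=
            mul_le_mul_of_nonneg_left hb (by positivity)
        _ = _ := by field_simp
    calc ∫ t in (0:ℝ)..1, G t ≤ ∫ _t in (0:ℝ)..1, c / (2 * Real.pi ^ 2) * P2 :=
          intervalIntegral.integral_mono_on zero_le_one (hGc.intervalIntegrable _ _)
            (continuous_const.intervalIntegrable _ _) hle
      _ = _ := by simp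

lemma sample_sum (c : ℝ) (hc : 0 < c) (σ : ℝ) (m : ℕ) (hm : 1 ≤ m) (p : ℝ → ℂ)
    (hp : Continuous p) (t : ℝ) :
    ∑' k : ℤ, ‖heatSample c (GaussHat σ)
      (Set.indicator (Set.Icc (-c) c) p) t ((m:ℝ)*Real.pi/c*(k:ℝ))‖^2
      = c / (2 * Real.pi ^ 2 * m) *
        ∫ ξ in (-c)..(-c + 2 * c / m), ‖∑ j : Fin m, p (ξ + j * (2 * c / m)) *
          Complex.exp (-((σ ^ 2 * (ξ + j * (2 * c / m)) ^ 2 : ℝ) : ℂ) * t)‖ ^ 2 := by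
  rw [← parseval_sample c hc m hm
    (fun ξ => p ξ * Complex.exp (-((σ ^ 2 * ξ ^ 2 : ℝ) : ℂ) * t)) (by fun_prop)]
  refine tsum_congr fun k => ?_
  have : heatSample c (GaussHat σ) (Set.indicator (Set.Icc (-c) c) p) t
      ((m:ℝ)*Real.pi/c*(k:ℝ)) = ((1 / (2 * Real.pi) : ℝ) : ℂ) * ∫ ξ in (-c)..c,
        p ξ * Complex.exp (-((σ ^ 2 * ξ ^ 2 : ℝ) : ℂ) * t) *
        Complex.exp (Complex.I * (((m:ℝ) * Real.pi / c * (k:ℝ) : ℝ) : ℂ) * ξ) := by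
    rw [heatSample]
    refine congrArg _ (intervalIntegral.integral_congr fun x hx => ?_)
    rw [Set.uIcc_of_le (by linarith)] at hx
    have hg : (((GaussHat σ x) ^ t : ℝ) : ℂ)
        = Complex.exp (-((σ ^ 2 * x ^ 2 : ℝ) : ℂ) * t) := by
      rw [GaussHat, ← Real.exp_mul]
      push_cast
      rfl
    simp only [Set.indicator_of_mem hx, hg]
  rw [this]

/-- Theorem `thm:gauss_body` for the model `V_N` of sparse sinc translates.
Here `f = Σ_{n=1}^N a_n sinc(c(·-λ_n))`, whose Fourier transform is
`f̂(ξ) = (π/c)·Σ_n a_n e^{-iλ_n ξ}·1_{[-c,c]}(ξ)`. -/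
theorem stmt11 (c : ℝ) (hc : 0 < c) :
    ∃ κ₀ κ₁ κ₂ κ₃ : ℝ, 0 < κ₀ ∧ 0 < κ₁ ∧ 0 < κ₂ ∧ 0 < κ₃ ∧
      ∀ σ : ℝ, σ ≠ 0 → ∀ m : ℕ, 2 ≤ m → ∀ N : ℕ, 1 ≤ N →
        ∀ a : Fin N → ℂ, ∀ l : Fin N → ℝ,
          (c*κ₀/((σ*c)^2+(m:ℝ))) *
              Real.exp (-(κ₁*(N:ℝ)) -
                (m:ℝ)^2*(-(κ₂*Real.log |σ|) + κ₃*σ^2 + Real.log (m:ℝ))) *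
              (∫ ξ : ℝ, ‖Set.indicator (Set.Icc (-c) c)
                  (fun x : ℝ => ((Real.pi/c : ℝ) : ℂ) *
                    ∑ n : Fin N, a n * Complex.exp (-(Complex.I * (l n) * x))) ξ‖^2)
            ≤ ∫ t in (0:ℝ)..1, ∑' k : ℤ,
                ‖heatSample c (GaussHat σ)
                    (Set.indicator (Set.Icc (-c) c)
                      (fun x : ℝ => ((Real.pi/c : ℝ) : ℂ) *
                        ∑ n : Fin N, a n * Complex.exp (-(Complex.I * (l n) * x))))
                    t ((m:ℝ)*Real.pi/c*(k:ℝ))‖^2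
          ∧ ∫ t in (0:ℝ)..1, ∑' k : ℤ,
                ‖heatSample c (GaussHat σ)
                    (Set.indicator (Set.Icc (-c) c)
                      (fun x : ℝ => ((Real.pi/c : ℝ) : ℂ) *
                        ∑ n : Fin N, a n * Complex.exp (-(Complex.I * (l n) * x))))
                    t ((m:ℝ)*Real.pi/c*(k:ℝ))‖^2
            ≤ c/(2*Real.pi^2) *
                ∫ ξ : ℝ, ‖Set.indicator (Set.Icc (-c) c)
                  (fun x : ℝ => ((Real.pi/c : ℝ) : ℂ) *
                    ∑ n : Fin N, a n * Complex.exp (-(Complex.I * (l n) * x))) ξ‖^2 := by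
  refine ⟨1 / (16 * Real.pi ^ 2), Real.log 25600, 4,
    2 + 2 * c ^ 2 + Real.exp (8 + 2 * |Real.log c|), by positivity,
    Real.log_pos (by norm_num), by norm_num, by positivity, ?_⟩
  intro σ hσ m hm N hN a l
  have hm1 : 1 ≤ m := by omega
  have hm0 : (0:ℝ) < m := by exact_mod_cast hm1
  set p₀ : ℝ → ℂ := fun x : ℝ => ((Real.pi/c : ℝ) : ℂ) *
                    ∑ n : Fin N, a n * Complex.exp (-(Complex.I * (l n) * x)) with hp₀
  have hp : p₀ = fun x : ℝ => ∑ j, (((Real.pi/c : ℝ) : ℂ) * a j) *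
      Complex.exp (-(Complex.I * l j) * x) := by
    funext x
    simp only [hp₀, Finset.mul_sum]
    refine Finset.sum_congr rfl fun j _ => ?_
    rw [neg_mul, mul_assoc (_ : ℂ) (a j)]
  have hpc : Continuous p₀ := by rw [hp]; fun_prop
  have hnorm : ∫ ξ : ℝ, ‖Set.indicator (Set.Icc (-c) c) p₀ ξ‖ ^ 2
      = ∫ x in (-c)..c, ‖p₀ x‖ ^ 2 := by
    rw [intervalIntegral.integral_of_le (by linarith), ← integral_Icc_eq_integral_Ioc,
      ← integral_indicator measurableSet_Icc]
    refine integral_congr_ae (Filter.Eventually.of_forall fun x => ?_)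
    by_cases hx : x ∈ Set.Icc (-c) c
    · simp [Set.indicator_of_mem hx]
    · simp [Set.indicator_of_notMem hx]
  set G : ℝ → ℝ := fun t : ℝ => c / (2 * Real.pi ^ 2 * m) *
        ∫ ξ in (-c)..(-c + 2 * c / m), ‖∑ j : Fin m, p₀ (ξ + j * (2 * c / m)) *
          Complex.exp (-((σ ^ 2 * (ξ + j * (2 * c / m)) ^ 2 : ℝ) : ℂ) * t)‖ ^ 2 with hG
  have hsum : ∀ t : ℝ, ∑' k : ℤ, ‖heatSample c (GaussHat σ)
      (Set.indicator (Set.Icc (-c) c) p₀) t ((m:ℝ)*Real.pi/c*(k:ℝ))‖^2 = G t := by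
    intro t
    exact sample_sum c hc σ m hm1 p₀ hpc t
  simp only [hsum, hnorm]
  obtain ⟨hlow, hup⟩ := core_bounds c hc σ m hm1 N hN _ l p₀ hp G hG
  refine ⟨?_, hup⟩
  have hnum := numeric c hc σ hσ m hm N
  have hP0 : 0 ≤ ∫ x in (-c)..c, ‖p₀ x‖ ^ 2 :=
    intervalIntegral.integral_nonneg (by linarith) fun x _ => by positivity
  have h1 := (mul_le_mul_of_nonneg_right hnum hP0).trans hlow
  have hW : (0:ℝ) < 8 * 25600 ^ N * (m * (2 ^ (m - 1)) ^ 2) := by positivity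
  refine le_of_mul_le_mul_left ?_ hW
  refine le_trans (le_of_eq ?_) h1
  ring
end
end
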